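/- arXiv:1202.2183 — 3 statements merged into one kernel-verified Lean document; each statement's English description precedes it below -/
import Mathlib

section
/- Let ω be a majorant and let f be a harmonic mapping in the unit disk D. Then Λ_f(z) ≤ M ω(1/d(z)) for all z ∈ D and some constant M > 0 if and only if there is a constant M' > 0 such that for every z ∈ D and every r ∈ (0, 1−|z|], (1/|D(z,r)|) ∫_{D(z,r)} |f(ζ) − f(z)| dA(ζ) ≤ M' r ω(1/r), where |D(z,r)| = πr² is the area of the disk D(z,r) and dA is the area measure. -/
open Complex MeasureTheory Metric Set Real
open scoped ENNReal

/-- The Wirtinger derivative `f_z = (f_x - i f_y)/2` of `f` at `z`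
(real Fréchet derivative applied to the directions `1` and `i`). -/
noncomputable def wirtingerZ (f : ℂ → ℂ) (z : ℂ) : ℂ :=
  (fderiv ℝ f z 1 - Complex.I * fderiv ℝ f z Complex.I) / 2

/-- The Wirtinger derivative `f_z̄ = (f_x + i f_y)/2` of `f` at `z`. -/
noncomputable def wirtingerZbar (f : ℂ → ℂ) (z : ℂ) : ℂ :=
  (fderiv ℝ f z 1 + Complex.I * fderiv ℝ f z Complex.I) / 2

/-- `Λ_f(z) = |f_z(z)| + |f_z̄(z)|`. -/
noncomputable def Lam (f : ℂ → ℂ) (z : ℂ) : ℝ :=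
  ‖wirtingerZ f z‖ + ‖wirtingerZbar f z‖

/-- A complex-valued function is harmonic on a set: it is `C²` there and its
Laplacian `f_xx + f_yy` vanishes (equivalently, its real and imaginary parts are
real harmonic). -/
def IsHarmonicOn (f : ℂ → ℂ) (s : Set ℂ) : Prop :=
  ContDiffOn ℝ 2 f s ∧ ∀ z ∈ s,
    fderiv ℝ (fun w => fderiv ℝ f w 1) z 1
      + fderiv ℝ (fun w => fderiv ℝ f w Complex.I) z Complex.I = 0

/-- A majorant: a continuous increasing function `ω : [0,∞) → [0,∞)` with
`ω 0 = 0` such that `ω t / t` is non-increasing for `t > 0`. -/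
def IsMajorant (ω : ℝ → ℝ) : Prop :=
  ContinuousOn ω (Ici 0) ∧ MonotoneOn ω (Ici 0) ∧ ω 0 = 0 ∧
    ∀ s t : ℝ, 0 < s → s ≤ t → ω t / t ≤ ω s / s


lemma harm_conv (f : ℂ → ℂ) (hf : IsHarmonicOn f (ball (0 : ℂ) 1)) :
    InnerProductSpace.HarmonicOnNhd f (ball (0:ℂ) 1) := by
  intro x hx
  have hC : ∀ y ∈ ball (0:ℂ) 1, ContDiffAt ℝ 2 f y := fun y hy =>
    hf.1.contDiffAt (isOpen_ball.mem_nhds hy)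
  refine ⟨hC x hx, ?_⟩
  filter_upwards [isOpen_ball.mem_nhds hx] with y hy
  have hd : DifferentiableAt ℝ (fderiv ℝ f) y :=
    ((hC y hy).fderiv_right (m := 1) (by norm_num)).differentiableAt (by norm_num)
  have h2 := hf.2 y hy
  rw [InnerProductSpace.laplacian_eq_iteratedFDeriv_complexPlane]
  simp only [iteratedFDeriv_two_apply]
  rw [fderiv_clm_apply hd (by fun_prop), fderiv_clm_apply hd (by fun_prop)] at h2
  simpa using h2

lemma circle_est (H : ℂ → ℂ) (z : ℂ) (R ρ : ℝ) (hρ : 0 < ρ) (hρR : ρ < R)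
    (hH : DifferentiableOn ℂ H (ball z R)) :
    ENNReal.ofReal (π * ρ * ‖deriv H z‖) ≤
      ∫⁻ θ in Ioo (-π) π, ‖(H (circleMap z ρ θ)).re - (H z).re‖ₑ := by
  set G : ℂ → ℂ := fun w => H w - H z with hG
  have hGd : DifferentiableOn ℂ G (ball z R) := hH.sub_const _
  have hsub : closedBall z ρ ⊆ ball z R := closedBall_subset_ball hρR
  have h1 := two_pi_I_inv_smul_circleIntegral_sub_sq_inv_smul_of_differentiable isOpen_ball hsub
    hGd (mem_ball_self hρ)
  have h2 : (∮ w in C(z, ρ), G w) = 0 :=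
    circleIntegral_eq_zero_of_differentiable_on_off_countable hρ.le countable_empty
      (hGd.continuousOn.mono hsub)
      (fun w hw => hGd.differentiableAt (isOpen_ball.mem_nhds (hsub (ball_subset_closedBall hw.1))))
  have hderiv : deriv G z = deriv H z := by simp [hG]
  rw [hderiv] at h1
  have hne : ∀ θ, circleMap 0 ρ θ ≠ 0 := fun θ => circleMap_ne_center hρ.ne'
  have hcont : Continuous (fun θ => G (circleMap z ρ θ)) :=
    (hGd.continuousOn.mono hsub).comp_continuous (continuous_circleMap z ρ)
      (fun θ => circleMap_mem_closedBall z hρ.le θ)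
  have hce : Continuous (fun θ => (circleMap 0 ρ θ)⁻¹) :=
    (continuous_circleMap 0 ρ).inv₀ hne
  have I1 : ∫ θ in (0)..(2*π), (circleMap 0 ρ θ)⁻¹ * G (circleMap z ρ θ) = 2 * π * deriv H z := by
    rw [← h1, circleIntegral]
    have : ∀ θ, deriv (circleMap z ρ) θ • ((circleMap z ρ θ - z) ^ 2)⁻¹ • G (circleMap z ρ θ)
        = I * ((circleMap 0 ρ θ)⁻¹ * G (circleMap z ρ θ)) := by
      intro θ
      have := hne θ
      simp only [deriv_circleMap, circleMap_sub_center, smul_eq_mul]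
      field_simp
    simp_rw [this]
    rw [intervalIntegral.integral_const_mul, smul_eq_mul]
    have : (π:ℂ) ≠ 0 := by exact_mod_cast Real.pi_ne_zero
    field_simp [Complex.I_ne_zero]
  have I2 : ∫ θ in (0)..(2*π), (circleMap 0 ρ θ)⁻¹ * (starRingEnd ℂ) (G (circleMap z ρ θ)) = 0 := by
    rw [circleIntegral] at h2
    have h3 : ∫ θ in (0)..(2*π), circleMap 0 ρ θ * G (circleMap z ρ θ) = 0 := by
      have : ∀ θ, deriv (circleMap z ρ) θ • G (circleMap z ρ θ)
        = I * (circleMap 0 ρ θ * G (circleMap z ρ θ)) := by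
        intro θ
        simp only [deriv_circleMap, smul_eq_mul]
        ring
      simp_rw [this] at h2
      rw [intervalIntegral.integral_const_mul] at h2
      simpa using h2
    have h4 : ∀ θ, (circleMap 0 ρ θ)⁻¹ * (starRingEnd ℂ) (G (circleMap z ρ θ))
        = ((ρ:ℂ)^2)⁻¹ * (starRingEnd ℂ) (circleMap 0 ρ θ * G (circleMap z ρ θ)) := by
      intro θ
      have h5 : circleMap 0 ρ θ * (starRingEnd ℂ) (circleMap 0 ρ θ) = (ρ:ℂ)^2 := by
        rw [Complex.mul_conj, Complex.normSq_eq_norm_sq]; simp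
      have := hne θ
      have hr : (ρ:ℂ) ≠ 0 := by exact_mod_cast hρ.ne'
      rw [map_mul]
      field_simp
      rw [← h5]; ring
    simp_rw [h4]
    rw [intervalIntegral.integral_const_mul, intervalIntegral.integral_of_le Real.two_pi_pos.le,
      integral_conj, ← intervalIntegral.integral_of_le Real.two_pi_pos.le, h3]
    simp
  have I3 : ∫ θ in (0)..(2*π), (circleMap 0 ρ θ)⁻¹ * ((G (circleMap z ρ θ)).re : ℂ)
      = π * deriv H z := by
    have : ∀ θ, (circleMap 0 ρ θ)⁻¹ * ((G (circleMap z ρ θ)).re : ℂ) =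
      (1/2 : ℂ) * ((circleMap 0 ρ θ)⁻¹ * G (circleMap z ρ θ) +
        (circleMap 0 ρ θ)⁻¹ * (starRingEnd ℂ) (G (circleMap z ρ θ))) := by
      intro θ
      rw [Complex.re_eq_add_conj]; ring
    simp_rw [this]
    rw [intervalIntegral.integral_const_mul, intervalIntegral.integral_add, I1, I2]
    · ring
    · exact (hce.mul hcont).intervalIntegrable _ _
    · exact (hce.mul (Complex.continuous_conj.comp hcont)).intervalIntegrable _ _
  have I4 : ∫ θ in (-π)..π, (circleMap 0 ρ θ)⁻¹ * ((G (circleMap z ρ θ)).re : ℂ)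
      = π * deriv H z := by
    rw [← I3]
    have hp : Function.Periodic
        (fun θ => (circleMap 0 ρ θ)⁻¹ * ((G (circleMap z ρ θ)).re : ℂ)) (2*π) := by
      intro θ
      simp only [periodic_circleMap _ _ θ]
    have := hp.intervalIntegral_add_eq (-π) 0
    convert! this using 2 <;> ring
  rw [intervalIntegral.integral_of_le (by linarith [Real.pi_pos]), integral_Ioc_eq_integral_Ioo]
    at I4
  have h6 := enorm_integral_le_lintegral_enorm (μ := volume.restrict (Ioo (-π) π))
    (fun θ => (circleMap 0 ρ θ)⁻¹ * ((G (circleMap z ρ θ)).re : ℂ))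
  rw [I4] at h6
  have h7 : ∀ θ, ‖(circleMap 0 ρ θ)⁻¹ * ((G (circleMap z ρ θ)).re : ℂ)‖ₑ =
      ENNReal.ofReal ρ⁻¹ * ‖(H (circleMap z ρ θ)).re - (H z).re‖ₑ := by
    intro θ
    rw [enorm_mul]
    congr 1
    · rw [← ofReal_norm]; simp [abs_of_pos hρ]
    · rw [← ofReal_norm, ← ofReal_norm, Complex.norm_real]; simp [hG]
  simp_rw [h7] at h6
  rw [lintegral_const_mul' _ _ ENNReal.ofReal_ne_top] at h6
  calc ENNReal.ofReal (π * ρ * ‖deriv H z‖) = ENNReal.ofReal ρ * ‖(π:ℂ) * deriv H z‖ₑ := by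
        rw [← ofReal_norm, ← ENNReal.ofReal_mul hρ.le]
        congr 1
        rw [norm_mul, Complex.norm_real, Real.norm_of_nonneg Real.pi_pos.le]; ring
    _ ≤ ENNReal.ofReal ρ * (ENNReal.ofReal ρ⁻¹ *
        ∫⁻ θ in Ioo (-π) π, ‖(H (circleMap z ρ θ)).re - (H z).re‖ₑ) := by gcongr
    _ = _ := by
      rw [← mul_assoc, ← ENNReal.ofReal_mul hρ.le, mul_inv_cancel₀ hρ.ne']; simp

lemma area_est (H : ℂ → ℂ) (z : ℂ) (R r : ℝ) (hr : 0 < r) (hrR : r < R)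
    (hH : DifferentiableOn ℂ H (ball z R)) :
    π * r ^ 3 / 8 * ‖deriv H z‖ ≤ ∫ ζ in ball z r, ‖(H ζ).re - (H z).re‖ := by
  have hsub : closedBall z r ⊆ ball z R := closedBall_subset_ball hrR
  set u : ℂ → ℝ := fun ζ => (H ζ).re - (H z).re with hu
  have hcont : ContinuousOn u (closedBall z r) :=
    (Complex.continuous_re.comp_continuousOn (hH.continuousOn.mono hsub)).sub continuousOn_const
  have hint : IntegrableOn u (ball z r) :=
    (hcont.integrableOn_compact (isCompact_closedBall z r)).mono_set ball_subset_closedBall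
  rw [← ENNReal.ofReal_le_ofReal_iff (by positivity), ofReal_integral_norm_eq_lintegral_enorm hint]
  set g : ℂ → ℝ≥0∞ := (ball z r).indicator (fun ζ => ‖u ζ‖ₑ) with hg
  have hgm : Measurable g := by
    have hm : Measurable ((ball z r).indicator u) := by
      classical
      rw [← Set.piecewise_eq_indicator]
      exact ContinuousOn.measurable_piecewise (hcont.mono ball_subset_closedBall)
        continuous_zero.continuousOn measurableSet_ball
    have : g = fun ζ => ‖(ball z r).indicator u ζ‖ₑ := by
      ext ζ; simp [hg, enorm_indicator_eq_indicator_enorm]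
    rw [this]
    exact hm.enorm
  rw [← lintegral_indicator measurableSet_ball]
  change _ ≤ ∫⁻ ζ, g ζ
  rw [← lintegral_add_left_eq_self g z, ← Complex.lintegral_comp_polarCoord_symm]
  have hpm : Measurable (fun p : ℝ × ℝ => ENNReal.ofReal p.1 • g (z + Complex.polarCoord.symm p)) := by
    have : Measurable (fun p : ℝ × ℝ => Complex.polarCoord.symm p) := by
      simp_rw [Complex.polarCoord_symm_apply]; fun_prop
    simp only [smul_eq_mul]
    exact (by fun_prop : Measurable fun p : ℝ × ℝ => ENNReal.ofReal p.1).mul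
      (hgm.comp (measurable_const.add this))
  rw [polarCoord_target, Measure.volume_eq_prod, setLIntegral_prod _ hpm.aemeasurable]
  calc ENNReal.ofReal (π * r ^ 3 / 8 * ‖deriv H z‖) 
      = ∫⁻ ρ in Ioo (r/2) r, ENNReal.ofReal (r/2) * ENNReal.ofReal (π * (r/2) * ‖deriv H z‖) := by
        rw [setLIntegral_const, Real.volume_Ioo, ← ENNReal.ofReal_mul (by positivity),
          ← ENNReal.ofReal_mul (by positivity)]
        congr 1; ring
    _ ≤ ∫⁻ ρ in Ioo (r/2) r, ∫⁻ θ in Ioo (-π) π, 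
          ENNReal.ofReal ρ • g (z + Complex.polarCoord.symm (ρ, θ)) := by
        refine setLIntegral_mono' measurableSet_Ioo fun ρ hρ => ?_
        have hρ0 : 0 < ρ := by linarith [hρ.1]
        simp only [smul_eq_mul]
        rw [lintegral_const_mul' _ _ ENNReal.ofReal_ne_top]
        refine mul_le_mul' (ENNReal.ofReal_le_ofReal hρ.1.le) ?_
        have h1 : ∀ θ, z + Complex.polarCoord.symm (ρ, θ) = circleMap z ρ θ := by
          intro θ
          rw [Complex.polarCoord_symm_apply, circleMap, Complex.exp_mul_I]; simp
        have h2 : ∀ θ, g (z + Complex.polarCoord.symm (ρ, θ)) = ‖u (circleMap z ρ θ)‖ₑ := by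
          intro θ
          rw [h1, hg, indicator_of_mem]
          simp [circleMap, abs_of_pos hρ0, hρ.2]
        simp_rw [h2]
        refine le_trans (ENNReal.ofReal_le_ofReal ?_)
          (circle_est H z R ρ hρ0 (hρ.2.trans hrR) hH)
        have := hρ.1.le
        gcongr
    _ ≤ _ := by
        refine lintegral_mono_set ?_
        intro ρ hρ
        exact lt_trans (by linarith) hρ.1

lemma omega_nonneg {ω : ℝ → ℝ} (hω : IsMajorant ω) {t : ℝ} (ht : 0 ≤ t) : 0 ≤ ω t := by
  have := hω.2.1 (mem_Ici.2 le_rfl) (mem_Ici.2 ht) ht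
  rwa [hω.2.2.1] at this

lemma fderiv_decomp (f : ℂ → ℂ) (z v : ℂ) :
    fderiv ℝ f z v = wirtingerZ f z * v + wirtingerZbar f z * (starRingEnd ℂ) v := by
  have h : v = v.re • (1:ℂ) + v.im • I := by
    apply Complex.ext <;> simp
  conv_lhs => rw [h]
  rw [map_add, map_smul, map_smul]
  have h1 : v = v.re + v.im * I := (Complex.re_add_im v).symm
  have h2 : (starRingEnd ℂ) v = v.re - v.im * I := by
    apply Complex.ext <;> simp
  rw [h2]
  conv_rhs => rw [show wirtingerZ f z * v = wirtingerZ f z * (v.re + v.im * I) by rw [← h1]]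
  simp only [wirtingerZ, wirtingerZbar, Complex.real_smul]
  linear_combination ((v.im:ℂ) * fderiv ℝ f z I) * Complex.I_sq

lemma fderiv_le_Lam (f : ℂ → ℂ) (z v : ℂ) : ‖fderiv ℝ f z v‖ ≤ Lam f z * ‖v‖ := by
  rw [fderiv_decomp, Lam, add_mul]
  refine (norm_add_le _ _).trans ?_
  simp

lemma Lam_le (f : ℂ → ℂ) (z : ℂ) {K : ℝ} (hK : ∀ v, ‖fderiv ℝ f z v‖ ≤ K * ‖v‖) :
    Lam f z ≤ 2 * K := by
  have h1 := hK 1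
  have h2 := hK I
  simp only [norm_one, mul_one, norm_I] at h1 h2
  unfold Lam wirtingerZ wirtingerZbar
  rw [norm_div, norm_div]
  have h3 := norm_sub_le (fderiv ℝ f z 1) (I * fderiv ℝ f z I)
  have h4 := norm_add_le (fderiv ℝ f z 1) (I * fderiv ℝ f z I)
  simp only [norm_mul, norm_I, one_mul] at h3 h4
  norm_num
  linarith

lemma real_grad (u : ℂ → ℝ) (z : ℂ) (R r : ℝ) (hr : 0 < r) (hrR : r < R)
    (hu : InnerProductSpace.HarmonicOnNhd u (ball z R)) (v : ℂ) :
    π * r ^ 3 / 8 * ‖fderiv ℝ u z v‖ ≤ (∫ ζ in ball z r, ‖u ζ - u z‖) * ‖v‖ := by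
  obtain ⟨H, hH, hHu⟩ := hu.exists_analyticOnNhd_ball_re_eq
  have hz : z ∈ ball z R := mem_ball_self (hr.trans hrR)
  have h1 := area_est H z R r hr hrR hH.differentiableOn
  have h2 : ∫ ζ in ball z r, ‖(H ζ).re - (H z).re‖ = ∫ ζ in ball z r, ‖u ζ - u z‖ := by
    refine setIntegral_congr_fun measurableSet_ball fun ζ hζ => ?_
    have e1 := hHu (ball_subset_ball hrR.le hζ)
    have e2 := hHu hz
    simp only at e1 e2
    simp only [e1, e2]
  rw [h2] at h1
  have h3 : HasFDerivAt u (reCLM.comp ((ContinuousLinearMap.toSpanSingleton ℂ (deriv H z)).restrictScalars ℝ)) z := by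
    have ha : HasFDerivAt H (ContinuousLinearMap.toSpanSingleton ℂ (deriv H z)) z :=
      (hH z hz).differentiableAt.hasDerivAt.hasFDerivAt
    have hb := (reCLM.hasFDerivAt (x := H z)).comp z (ha.restrictScalars ℝ)
    refine hb.congr_of_eventuallyEq ?_
    filter_upwards [isOpen_ball.mem_nhds hz] with w hw
    exact (hHu hw).symm
  rw [h3.fderiv]
  have h4 : ‖(reCLM.comp ((ContinuousLinearMap.toSpanSingleton ℂ (deriv H z)).restrictScalars ℝ)) v‖
      ≤ ‖deriv H z‖ * ‖v‖ := by
    simp only [ContinuousLinearMap.comp_apply, ContinuousLinearMap.coe_restrictScalars',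
      ContinuousLinearMap.toSpanSingleton_apply, smul_eq_mul, reCLM_apply]
    refine (Complex.abs_re_le_norm _).trans ?_
    rw [norm_mul, mul_comm]
  calc _ ≤ π * r ^ 3 / 8 * (‖deriv H z‖ * ‖v‖) := by gcongr
    _ = (π * r ^ 3 / 8 * ‖deriv H z‖) * ‖v‖ := by ring
    _ ≤ _ := by gcongr

lemma grad_est (f : ℂ → ℂ) (z : ℂ) (R r : ℝ) (hr : 0 < r) (hrR : r < R)
    (hf : InnerProductSpace.HarmonicOnNhd f (ball z R)) :
    π * r ^ 3 / 32 * Lam f z ≤ ∫ ζ in ball z r, ‖f ζ - f z‖ := by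
  have hsub : closedBall z r ⊆ ball z R := closedBall_subset_ball hrR
  have hz : z ∈ ball z R := mem_ball_self (hr.trans hrR)
  have hint : IntegrableOn (fun ζ => ‖f ζ - f z‖) (ball z r) :=
    (((hf.continuousOn.mono hsub).sub continuousOn_const).norm.integrableOn_compact
      (isCompact_closedBall z r)).mono_set ball_subset_closedBall
  have hre := real_grad (reCLM ∘ f) z R r hr hrR (hf.comp_CLM reCLM)
  have him := real_grad (imCLM ∘ f) z R r hr hrR (hf.comp_CLM imCLM)
  have ire : ∫ ζ in ball z r, ‖(reCLM ∘ f) ζ - (reCLM ∘ f) z‖ ≤ ∫ ζ in ball z r, ‖f ζ - f z‖ := by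
    refine integral_mono_of_nonneg (Filter.Eventually.of_forall fun _ => norm_nonneg _) hint
      (Filter.Eventually.of_forall fun ζ => ?_)
    simpa using Complex.abs_re_le_norm (f ζ - f z)
  have iim : ∫ ζ in ball z r, ‖(imCLM ∘ f) ζ - (imCLM ∘ f) z‖ ≤ ∫ ζ in ball z r, ‖f ζ - f z‖ := by
    refine integral_mono_of_nonneg (Filter.Eventually.of_forall fun _ => norm_nonneg _) hint
      (Filter.Eventually.of_forall fun ζ => ?_)
    simpa using Complex.abs_im_le_norm (f ζ - f z)
  have hd : DifferentiableAt ℝ f z := (hf z hz).1.differentiableAt (by norm_num)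
  set J := ∫ ζ in ball z r, ‖f ζ - f z‖
  have hc : 0 < π * r ^ 3 / 8 := by positivity
  have key := Lam_le f z (K := 2 * (J / (π * r ^ 3 / 8))) (fun v => by
    have e1 : fderiv ℝ (reCLM ∘ f) z v = (fderiv ℝ f z v).re := by
      rw [(reCLM.hasFDerivAt.comp z hd.hasFDerivAt).fderiv]; simp
    have e2 : fderiv ℝ (imCLM ∘ f) z v = (fderiv ℝ f z v).im := by
      rw [(imCLM.hasFDerivAt.comp z hd.hasFDerivAt).fderiv]; simp
    have h1 := hre v
    have h2 := him v
    rw [e1] at h1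
    rw [e2] at h2
    have h3 := Complex.norm_le_abs_re_add_abs_im (fderiv ℝ f z v)
    have h4 : π * r ^ 3 / 8 * ‖fderiv ℝ f z v‖ ≤ 2 * J * ‖v‖ := by
      have := mul_le_mul_of_nonneg_left h3 hc.le
      have := mul_le_mul_of_nonneg_right ire (norm_nonneg v)
      have := mul_le_mul_of_nonneg_right iim (norm_nonneg v)
      simp only [Real.norm_eq_abs] at *
      nlinarith
    have h5 : 2 * (J / (π * r ^ 3 / 8)) * ‖v‖ = (2 * J * ‖v‖) / (π * r ^ 3 / 8) := by ring
    rw [h5, le_div_iff₀ hc]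
    linarith)
  have h6 : 2 * (2 * (J / (π * r ^ 3 / 8))) = (4 * J) / (π * r ^ 3 / 8) := by ring
  rw [h6, le_div_iff₀ hc] at key
  linarith

lemma back_dir (ω : ℝ → ℝ) (hω : IsMajorant ω) (f : ℂ → ℂ)
    (hf : InnerProductSpace.HarmonicOnNhd f (ball (0 : ℂ) 1)) (M : ℝ) (hM : 0 < M)
    (h : ∀ z ∈ ball (0 : ℂ) 1, ∀ r : ℝ, 0 < r → r ≤ 1 - ‖z‖ →
        (π * r ^ 2)⁻¹ * (∫ ζ in ball z r, ‖f ζ - f z‖) ≤ M * (r * ω (1 / r)))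
    (z : ℂ) (hz : z ∈ ball (0:ℂ) 1) : Lam f z ≤ (64 * M) * ω (1 / (1 - ‖z‖)) := by
  have hz1 : ‖z‖ < 1 := by simpa using hz
  set d := 1 - ‖z‖ with hd
  have hd0 : 0 < d := by linarith
  have hsub : ball z d ⊆ ball 0 1 := by
    apply ball_subset_ball'
    simp [hd]
  have h1 := grad_est f z d (d/2) (by linarith) (by linarith) (hf.mono hsub)
  have h2 := h z hz (d/2) (by linarith) (by linarith)
  set J := ∫ ζ in ball z (d/2), ‖f ζ - f z‖
  rw [inv_mul_le_iff₀ (by positivity)] at h2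
  have h3 := hω.2.2.2 (1/d) (1/(d/2)) (by positivity) (by gcongr; linarith)
  rw [div_le_div_iff₀ (by positivity) (by positivity)] at h3
  have h4 : ω (1/(d/2)) ≤ 2 * ω (1/d) := by
    have : 1/(d/2) = 2 * (1/d) := by field_simp
    rw [this] at h3 ⊢
    have hp : 0 < 1/d := by positivity
    refine le_of_mul_le_mul_right ?_ hp
    linarith
  have hc : 0 < π * (d/2)^3 / 32 := by positivity
  refine le_of_mul_le_mul_left ?_ hc
  calc _ ≤ J := h1
    _ ≤ π * (d/2)^2 * (M * (d/2 * (2 * ω (1/d)))) := h2.trans (by gcongr)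
    _ = _ := by ring

lemma pointwise (ω : ℝ → ℝ) (hω : IsMajorant ω) (f : ℂ → ℂ)
    (hf : ∀ z ∈ ball (0:ℂ) 1, DifferentiableAt ℝ f z) (M : ℝ) (hM : 0 < M)
    (h : ∀ z ∈ ball (0 : ℂ) 1, Lam f z ≤ M * ω (1 / (1 - ‖z‖)))
    (z : ℂ) (r : ℝ) (hr : 0 < r) (hrz : r ≤ 1 - ‖z‖) (ζ : ℂ) (hζ : ζ ∈ ball z r) :
    ‖f ζ - f z‖ ≤ M * ω (1/r) * r * (-Real.log (1 - ‖ζ - z‖ / r)) := by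
  set s := ‖ζ - z‖ with hs
  have hsr : s < r := by simpa [dist_eq_norm] using hζ
  have hs0 : 0 ≤ s := norm_nonneg _
  have hpath : ∀ t ∈ Icc (0:ℝ) 1, ‖z + t • (ζ - z)‖ ≤ ‖z‖ + t * s := by
    intro t ht
    refine (norm_add_le _ _).trans ?_
    rw [norm_smul, Real.norm_of_nonneg ht.1]
  have hts : ∀ t ∈ Icc (0:ℝ) 1, t * s < r := fun t ht => by nlinarith [ht.1, ht.2]
  have hin : ∀ t ∈ Icc (0:ℝ) 1, z + t • (ζ - z) ∈ ball (0:ℂ) 1 := by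
    intro t ht
    have := hpath t ht
    have := hts t ht
    simp only [mem_ball_zero_iff]
    linarith
  have hder : ∀ t ∈ Icc (0:ℝ) 1, HasDerivAt (fun t : ℝ => f (z + t • (ζ - z)) - f z)
      (fderiv ℝ f (z + t • (ζ - z)) (ζ - z)) t := by
    intro t ht
    have h1 : HasDerivAt (fun t : ℝ => z + t • (ζ - z)) (ζ - z) t := by
      simpa using ((hasDerivAt_id t).smul_const (ζ - z)).const_add z
    exact ((hf _ (hin t ht)).hasFDerivAt.comp_hasDerivAt t h1).sub_const _
  have hB : ∀ t ∈ Icc (0:ℝ) 1, HasDerivAt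
      (fun t : ℝ => M * ω (1/r) * r * (-Real.log (1 - t * s / r)))
      (M * ω (1/r) * r * (s / (r - t * s))) t := by
    intro t ht
    have h0 := hts t ht
    have hne : 1 - t * s / r ≠ 0 := by
      have : t * s / r < 1 := by rw [div_lt_one hr]; exact h0
      linarith
    have h1 : HasDerivAt (fun t : ℝ => 1 - t * s / r) (-(s / r)) t := by
      simpa using (((hasDerivAt_id t).mul_const s).div_const r).const_sub 1
    have h2 := ((h1.log hne).neg).const_mul (M * ω (1/r) * r)
    refine h2.congr_deriv ?_
    have : r - t * s ≠ 0 := by linarith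
    field_simp
  have main := image_norm_le_of_norm_deriv_right_le_deriv_boundary'
    (f := fun t : ℝ => f (z + t • (ζ - z)) - f z) (a := 0) (b := 1)
    (f' := fun t => fderiv ℝ f (z + t • (ζ - z)) (ζ - z))
    (B := fun t : ℝ => M * ω (1/r) * r * (-Real.log (1 - t * s / r)))
    (B' := fun t => M * ω (1/r) * r * (s / (r - t * s)))
    (fun t ht => (hder t ht).continuousAt.continuousWithinAt)
    (fun t ht => (hder t ⟨ht.1, ht.2.le⟩).hasDerivWithinAt) (by simp)
    (fun t ht => (hB t ht).continuousAt.continuousWithinAt)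
    (fun t ht => (hB t ⟨ht.1, ht.2.le⟩).hasDerivWithinAt) (by
      intro t ht
      have ht' : t ∈ Icc (0:ℝ) 1 := ⟨ht.1, ht.2.le⟩
      have h0 := hts t ht'
      have hp := hpath t ht'
      have hq : 0 < r - t * s := by linarith
      have hts0 : 0 ≤ t * s := mul_nonneg ht.1 hs0
      refine (fderiv_le_Lam _ _ _).trans ?_
      have h1 := h _ (hin t ht')
      set w := z + t • (ζ - z)
      have hw : r - t * s ≤ 1 - ‖w‖ := by linarith
      have h2 : ω (1 / (1 - ‖w‖)) ≤ ω (1 / (r - t * s)) := by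
        have hpos : 0 < 1 - ‖w‖ := by linarith
        apply hω.2.1 (mem_Ici.2 (by positivity)) (mem_Ici.2 (by positivity))
        gcongr
      have h3 := hω.2.2.2 (1/r) (1/(r - t*s)) (by positivity) (by gcongr; linarith)
      have h4 : ω (1 / (r - t * s)) ≤ ω (1/r) * r / (r - t * s) := by
        rw [div_div_eq_mul_div, div_div_eq_mul_div] at h3
        rw [le_div_iff₀ hq]
        simpa using h3
      calc Lam f w * s ≤ M * (ω (1/r) * r / (r - t * s)) * s := by
            gcongr
            refine h1.trans ?_
            gcongr
            exact h2.trans h4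
        _ = _ := by ring)
  have := main (x := 1) (by simp)
  simpa using this

lemma log_radial : ∃ C : ℝ, 0 ≤ C ∧ ∀ (z : ℂ) (r : ℝ), 0 < r →
    IntegrableOn (fun ζ : ℂ => -Real.log (1 - ‖ζ - z‖ / r)) (ball z r) ∧
    ∫ ζ in ball z r, -Real.log (1 - ‖ζ - z‖ / r) = C * r ^ 2 := by
  refine ⟨∫ w in ball (0:ℂ) 1, -Real.log (1 - ‖w‖), ?_, ?_⟩
  · refine setIntegral_nonneg measurableSet_ball fun w hw => ?_
    have : ‖w‖ < 1 := by simpa using hw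
    have := Real.log_nonpos (x := 1 - ‖w‖) (by linarith) (by linarith [norm_nonneg w])
    linarith
  have hI : IntegrableOn (fun w : ℂ => -Real.log (1 - ‖w‖)) (ball (0:ℂ) 1) := by
    rw [integrableOn_fun_norm_addHaar volume (f := fun y => -Real.log (1 - y))]
    have h1 : IntervalIntegrable (fun y : ℝ => Real.log (1 - y)) volume 0 1 := by
      have := (intervalIntegral.intervalIntegrable_log' (a := 1) (b := 0)).comp_sub_left 1
      simpa using this
    have h2 : IntervalIntegrable (fun y : ℝ => y ^ 1 * -Real.log (1 - y)) volume 0 1 :=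
      h1.neg.continuousOn_mul (by fun_prop)
    rw [intervalIntegrable_iff_integrableOn_Ioo_of_le zero_le_one] at h2
    simpa using h2
  intro z r hr
  -- change of variables ζ = z + r w
  set g : ℂ → ℝ := (ball (0:ℂ) 1).indicator (fun w => -Real.log (1 - ‖w‖)) with hg
  have hgI : Integrable g := hI.integrable_indicator measurableSet_ball
  have heq : (ball z r).indicator (fun ζ : ℂ => -Real.log (1 - ‖ζ - z‖ / r))
      = fun ζ => g (r⁻¹ • (ζ - z)) := by
    ext ζ
    have hn : ‖r⁻¹ • (ζ - z)‖ = ‖ζ - z‖ / r := by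
      rw [norm_smul, norm_inv, Real.norm_of_nonneg hr.le]; ring
    by_cases hζ : ζ ∈ ball z r
    · have h' : r⁻¹ • (ζ - z) ∈ ball (0:ℂ) 1 := by
        rw [mem_ball_zero_iff, hn, div_lt_one hr]; simpa [dist_eq_norm] using hζ
      rw [indicator_of_mem hζ, hg, indicator_of_mem h', hn]
    · have h' : r⁻¹ • (ζ - z) ∉ ball (0:ℂ) 1 := by
        rw [mem_ball_zero_iff, hn, div_lt_one hr]; simpa [dist_eq_norm] using hζ
      rw [indicator_of_notMem hζ, hg, indicator_of_notMem h']
  constructor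
  · rw [← integrable_indicator_iff measurableSet_ball, heq]
    exact (hgI.comp_smul (inv_ne_zero hr.ne')).comp_sub_right z
  · rw [← integral_indicator measurableSet_ball, heq,
      integral_sub_right_eq_self (fun ζ => g (r⁻¹ • ζ)) z, Measure.integral_comp_smul,
      ← integral_indicator measurableSet_ball, ← hg]
    simp [mul_comm]

lemma forward_dir (ω : ℝ → ℝ) (hω : IsMajorant ω) (f : ℂ → ℂ)
    (hf : ∀ z ∈ ball (0:ℂ) 1, DifferentiableAt ℝ f z) (M : ℝ) (hM : 0 < M)
    (h : ∀ z ∈ ball (0 : ℂ) 1, Lam f z ≤ M * ω (1 / (1 - ‖z‖))) :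
    ∃ M > (0 : ℝ), ∀ z ∈ ball (0 : ℂ) 1, ∀ r : ℝ, 0 < r → r ≤ 1 - ‖z‖ →
        (π * r ^ 2)⁻¹ * (∫ ζ in ball z r, ‖f ζ - f z‖) ≤ M * (r * ω (1 / r)) := by
  obtain ⟨C, hC, hlog⟩ := log_radial
  refine ⟨M * (C + 1) / π, by positivity, fun z hz r hr hrz => ?_⟩
  obtain ⟨hi, he⟩ := hlog z r hr
  have hω0 : 0 ≤ ω (1/r) := omega_nonneg hω (by positivity)
  have h1 : ∫ ζ in ball z r, ‖f ζ - f z‖ ≤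
      ∫ ζ in ball z r, M * ω (1/r) * r * (-Real.log (1 - ‖ζ - z‖ / r)) := by
    refine integral_mono_of_nonneg (Filter.Eventually.of_forall fun _ => norm_nonneg _)
      (hi.const_mul _) ?_
    filter_upwards [ae_restrict_mem measurableSet_ball] with ζ hζ
    exact pointwise ω hω f hf M hM h z r hr hrz ζ hζ
  rw [integral_const_mul, he] at h1
  rw [inv_mul_le_iff₀ (by positivity)]
  refine h1.trans ?_
  have : π * r ^ 2 * (M * (C + 1) / π * (r * ω (1 / r))) =
      M * ω (1/r) * r * ((C + 1) * r^2) := by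
    field_simp
  rw [this]
  gcongr
  linarith

/-- Theorem 1: for `ω` a majorant and `f` harmonic in the unit
disk, `Λ_f(z) ≤ M ω(1/d(z))` holds on `𝔻` for some `M > 0` iff there is `M' > 0`
such that for every `z ∈ 𝔻` and `r ∈ (0, 1-|z|]`,
`(1/(πr²)) ∫_{D(z,r)} |f(ζ) - f(z)| dA(ζ) ≤ M' r ω(1/r)`. -/
theorem stmt0 (ω : ℝ → ℝ) (hω : IsMajorant ω) (f : ℂ → ℂ)
    (hf : IsHarmonicOn f (ball (0 : ℂ) 1)) :
    (∃ M > (0 : ℝ), ∀ z ∈ ball (0 : ℂ) 1, Lam f z ≤ M * ω (1 / (1 - ‖z‖))) ↔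
      (∃ M > (0 : ℝ), ∀ z ∈ ball (0 : ℂ) 1, ∀ r : ℝ, 0 < r → r ≤ 1 - ‖z‖ →
        (π * r ^ 2)⁻¹ * (∫ ζ in ball z r, ‖f ζ - f z‖) ≤ M * (r * ω (1 / r))) := by
  have hh := harm_conv f hf
  constructor
  · rintro ⟨M, hM, h⟩
    exact forward_dir ω hω f (fun z hz => (hh z hz).1.differentiableAt (by norm_num)) M hM h
  · rintro ⟨M, hM, h⟩
    exact ⟨64 * M, by positivity, fun z hz => back_dir ω hω f hh M hM h z hz⟩
end

section
/- Let f be a harmonic mapping in the unit disk D. Then f ∈ BMO_1 (i.e., ‖f‖_{BMO_1} < ∞) if and only if there is a constant M > 0 such that Λ_f(z) ≤ M / d(z) for all z ∈ D. -/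
open Complex MeasureTheory Metric Set Real
open scoped ENNReal

/-- The `BMO_p` norm of `f` on the unit disk (valued in `ℝ≥0∞` so that membership in
`BMO_p` is finiteness): the supremum over all disks `D(z,r) ⊆ 𝔻` with `r ∈ (0, 1-|z|]`
of `{(1/(πr²)) ∫_{D(z,r)} |f(ζ) - (1/(πr²)) ∫_{D(z,r)} f dA|^p dA(ζ)}^{1/p}`. -/
noncomputable def bmoNorm (f : ℂ → ℂ) (p : ℝ) : ℝ≥0∞ :=
  ⨆ (z : ℂ) (_ : ‖z‖ < 1) (r : ℝ) (_ : 0 < r) (_ : r ≤ 1 - ‖z‖),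
    ENNReal.ofReal
      (((π * r ^ 2)⁻¹ *
          ∫ ζ in ball z r,
            ‖f ζ - (π * r ^ 2)⁻¹ • ∫ ξ in ball z r, f ξ‖ ^ p) ^ (1 / p))

open InnerProductSpace Laplacian in
theorem harm_aux (f : ℂ → ℂ) (hf : IsHarmonicOn f (ball (0 : ℂ) 1)) :
    HarmonicOnNhd f (ball (0:ℂ) 1) := by
  intro x hx
  have hc : ∀ y ∈ ball (0:ℂ) 1, ContDiffAt ℝ 2 f y := fun y hy =>
    hf.1.contDiffAt (isOpen_ball.mem_nhds hy)
  refine ⟨hc x hx, ?_⟩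
  filter_upwards [isOpen_ball.mem_nhds hx] with y hy
  have h := hf.2 y hy
  have h1 := hc y hy
  rw [fderiv_clm_apply (by fun_prop) (by fun_prop), fderiv_clm_apply (by fun_prop) (by fun_prop)] at h
  simp only [laplacian_eq_iteratedFDeriv_complexPlane, iteratedFDeriv_two_apply]
  simpa using h

theorem decomp (f : ℂ → ℂ) (hf : IsHarmonicOn f (ball (0 : ℂ) 1)) :
    ∃ h g : ℂ → ℂ, DifferentiableOn ℂ h (ball 0 1) ∧ DifferentiableOn ℂ g (ball 0 1) ∧
      ∀ z ∈ ball (0:ℂ) 1, f z = h z + (starRingEnd ℂ) (g z) := by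
  have hh := harm_aux f hf
  obtain ⟨F, hF, hF'⟩ := (hh.comp_CLM Complex.reCLM).exists_analyticOnNhd_ball_re_eq
  obtain ⟨G, hG, hG'⟩ := (hh.comp_CLM Complex.imCLM).exists_analyticOnNhd_ball_re_eq
  have hF1 := hF.differentiableOn
  have hG1 := hG.differentiableOn
  refine ⟨fun z => (F z + I * G z) / 2, fun z => (F z - I * G z) / 2, by fun_prop, by fun_prop, ?_⟩
  intro z hz
  have h1 := hF' hz
  have h2 := hG' hz
  simp only [Function.comp_apply, reCLM_apply, imCLM_apply] at h1 h2
  have e : (starRingEnd ℂ) ((F z - I * G z) / 2) =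
      ((starRingEnd ℂ) (F z) + I * (starRingEnd ℂ) (G z)) / 2 := by
    rw [map_div₀, map_ofNat]
    simp
  simp only [e]
  apply Complex.ext
  · rw [← h1]
    simp
    ring
  · rw [← h2]
    simp
    ring

theorem wirt (f h g : ℂ → ℂ) (hh : DifferentiableOn ℂ h (ball 0 1))
    (hg : DifferentiableOn ℂ g (ball 0 1))
    (hf : ∀ z ∈ ball (0:ℂ) 1, f z = h z + (starRingEnd ℂ) (g z)) (z : ℂ) (hz : z ∈ ball (0:ℂ) 1) :
    DifferentiableAt ℝ f z ∧ 
    (∀ v, fderiv ℝ f z v = deriv h z * v + (starRingEnd ℂ) (deriv g z * v)) ∧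
    Lam f z = ‖deriv h z‖ + ‖deriv g z‖ := by
  have h1 := ((hh.differentiableAt (isOpen_ball.mem_nhds hz)).hasDerivAt.hasFDerivAt).restrictScalars ℝ
  have h2 := ((hg.differentiableAt (isOpen_ball.mem_nhds hz)).hasDerivAt.hasFDerivAt).restrictScalars ℝ
  have h3 := h1.add ((Complex.conjCLE : ℂ →L[ℝ] ℂ).hasFDerivAt.comp z h2)
  have h4 := h3.congr_of_eventuallyEq (f₁ := f)
    (Filter.eventually_of_mem (isOpen_ball.mem_nhds hz) (fun y hy => by simp [hf y hy]))
  have h5 : ∀ v, fderiv ℝ f z v = deriv h z * v + (starRingEnd ℂ) (deriv g z * v) := by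
    intro v
    rw [h4.fderiv]
    simp [mul_comm]
  refine ⟨h4.differentiableAt, h5, ?_⟩
  unfold Lam wirtingerZ wirtingerZbar
  rw [h5, h5]
  have e1 : (deriv h z * 1 + (starRingEnd ℂ) (deriv g z * 1) -
    I * (deriv h z * I + (starRingEnd ℂ) (deriv g z * I))) / 2 = deriv h z := by
    simp
    linear_combination (-deriv h z / 2 + (starRingEnd ℂ) (deriv g z) / 2) * I_sq
  have e2 : (deriv h z * 1 + (starRingEnd ℂ) (deriv g z * 1) +
    I * (deriv h z * I + (starRingEnd ℂ) (deriv g z * I))) / 2 = (starRingEnd ℂ) (deriv g z) := by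
    simp
    linear_combination (deriv h z / 2 - (starRingEnd ℂ) (deriv g z) / 2) * I_sq
  rw [e1, e2]
  simp

theorem circ (h g : ℂ → ℂ) (hh : DifferentiableOn ℂ h (ball 0 1))
    (hg : DifferentiableOn ℂ g (ball 0 1)) (z : ℂ) (s : ℝ) (hs : 0 < s)
    (hz : closedBall z s ⊆ ball (0:ℂ) 1) :
    2 * π * s * ‖deriv h z‖ ≤ ∫ θ in (-π)..π, ‖h (circleMap z s θ) + (starRingEnd ℂ) (g (circleMap z s θ))‖ := by
  have hper : ∫ θ in (-π)..π, ‖h (circleMap z s θ) + (starRingEnd ℂ) (g (circleMap z s θ))‖ =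
      ∫ θ in (0:ℝ)..(2*π), ‖h (circleMap z s θ) + (starRingEnd ℂ) (g (circleMap z s θ))‖ := by
    have hp : Function.Periodic (fun θ => ‖h (circleMap z s θ) + (starRingEnd ℂ) (g (circleMap z s θ))‖) (2*π) := by
      intro θ
      simp only [periodic_circleMap z s θ]
    have := hp.intervalIntegral_add_eq (-π) 0
    rw [zero_add] at this
    rw [← this]
    congr 1
    ring
  rw [hper]
  have hmem : ∀ θ, circleMap z s θ ∈ ball (0:ℂ) 1 := fun θ => hz (circleMap_mem_closedBall z hs.le θ)
  have hch : Continuous fun θ => h (circleMap z s θ) :=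
    hh.continuousOn.comp_continuous (continuous_circleMap z s) hmem
  have hcg : Continuous fun θ => g (circleMap z s θ) :=
    hg.continuousOn.comp_continuous (continuous_circleMap z s) hmem
  have hD := two_pi_I_inv_smul_circleIntegral_sub_sq_inv_smul_of_differentiable isOpen_ball hz hh
    (mem_ball_self hs)
  have hE : ∮ w in C(z, s), g w = 0 :=
    Complex.circleIntegral_eq_zero_of_differentiable_on_off_countable hs.le countable_empty
      (hg.continuousOn.mono hz) (fun w hw => hg.differentiableAt
        (isOpen_ball.mem_nhds (hz (ball_subset_closedBall hw.1))))
  rw [circleIntegral] at hD hE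
  have hexp : ∀ θ : ℝ, (starRingEnd ℂ) (cexp (θ * I)) = cexp (-(θ * I)) := by
    intro θ
    rw [← Complex.exp_conj]; simp
  have hs0 : (s:ℂ) ≠ 0 := by exact_mod_cast hs.ne'
  have hD' : ∫ θ in (0:ℝ)..(2*π), h (circleMap z s θ) * cexp (-(θ * I)) = 2 * π * s * deriv h z := by
    rw [← hD, smul_eq_mul]
    have : ∀ θ : ℝ, deriv (circleMap z s) θ • ((circleMap z s θ - z) ^ 2)⁻¹ • h (circleMap z s θ) =
        (I / s) * (h (circleMap z s θ) * cexp (-(θ * I))) := by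
      intro θ
      have := Complex.exp_ne_zero (θ * I)
      simp only [deriv_circleMap, circleMap, zero_add, smul_eq_mul, add_sub_cancel_left, Complex.exp_neg]
      field_simp
    simp_rw [this]
    rw [intervalIntegral.integral_const_mul]
    have hpi : (π:ℂ) ≠ 0 := by exact_mod_cast Real.pi_ne_zero
    generalize (∫ θ in (0:ℝ)..(2*π), h (circleMap z s θ) * cexp (-(θ * I))) = J
    field_simp
  have hE' : ∫ θ in (0:ℝ)..(2*π), (starRingEnd ℂ) (g (circleMap z s θ)) * cexp (-(θ * I)) = 0 := by
    have : ∀ θ : ℝ, deriv (circleMap z s) θ • g (circleMap z s θ) =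
        (I * s) * (g (circleMap z s θ) * cexp (θ * I)) := by
      intro θ
      simp only [deriv_circleMap, circleMap, zero_add, smul_eq_mul]
      ring
    simp_rw [this] at hE
    rw [intervalIntegral.integral_const_mul] at hE
    have h0 : ∫ θ in (0:ℝ)..(2*π), (g (circleMap z s θ) * cexp (θ * I)) = 0 := by
      rcases mul_eq_zero.1 hE with h | h
      · simp [hs0] at h
      · exact h
    have h1 := congrArg (starRingEnd ℂ) h0
    rw [intervalIntegral.integral_of_le (by positivity), ← integral_conj,
      ← intervalIntegral.integral_of_le (by positivity)] at h1
    simpa [hexp] using h1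
  have hsum : ∫ θ in (0:ℝ)..(2*π), (h (circleMap z s θ) + (starRingEnd ℂ) (g (circleMap z s θ))) * cexp (-(θ * I)) = 2 * π * s * deriv h z := by
    simp_rw [add_mul]
    rw [intervalIntegral.integral_add, hD', hE', add_zero]
    · exact Continuous.intervalIntegrable (hch.mul (by fun_prop)) _ _
    · exact Continuous.intervalIntegrable
        ((Complex.continuous_conj.comp hcg).mul (by fun_prop)) _ _
  have : 2 * π * s * ‖deriv h z‖ = ‖2 * π * s * deriv h z‖ := by
    simp [abs_of_pos hs, abs_of_pos Real.pi_pos]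
  rw [this, ← hsum]
  refine (intervalIntegral.norm_integral_le_integral_norm (by positivity)).trans (le_of_eq ?_)
  congr 1
  ext θ
  rw [norm_mul, ← neg_mul, ← Complex.ofReal_neg, Complex.norm_exp_ofReal_mul_I, mul_one]

theorem polar_bound (h g : ℂ → ℂ) (hh : DifferentiableOn ℂ h (ball 0 1))
    (hg : DifferentiableOn ℂ g (ball 0 1)) (z : ℂ) (r : ℝ) (hr : 0 < r)
    (hz : closedBall z r ⊆ ball (0:ℂ) 1) :
    2 * π * ‖deriv h z‖ * (r ^ 3 / 3) ≤ ∫ w in ball z r, ‖h w + (starRingEnd ℂ) (g w)‖ := by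
  set u : ℂ → ℝ := fun w => ‖h w + (starRingEnd ℂ) (g w)‖ with hu
  have hcu : ContinuousOn u (closedBall z r) :=
    ((hh.continuousOn.mono hz).add
      (Complex.continuous_conj.comp_continuousOn (hg.continuousOn.mono hz))).norm
  have hmap : ∀ p : ℝ × ℝ, z + Complex.polarCoord.symm p = circleMap z p.1 p.2 := by
    intro p
    simp [circleMap, Complex.exp_mul_I]
  have e1 : ∫ w in ball z r, u w =
      ∫ p in Ioo 0 r ×ˢ Ioo (-π) π, p.1 * u (circleMap z p.1 p.2) := by
    rw [← integral_indicator measurableSet_ball,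
      ← integral_add_left_eq_self _ z, ← Complex.integral_comp_polarCoord_symm]
    have : Ioo 0 r ×ˢ Ioo (-π) π ⊆ polarCoord.target := by
      intro p hp
      exact ⟨hp.1.1, hp.2⟩
    rw [← inter_eq_self_of_subset_right this, ← setIntegral_indicator
      (measurableSet_Ioo.prod measurableSet_Ioo)]
    refine setIntegral_congr_fun polarCoord.open_target.measurableSet ?_
    intro p hp
    have hp1 : 0 < p.1 := hp.1
    have hp2 : p.2 ∈ Ioo (-π) π := hp.2
    simp only [hmap, indicator, mem_prod, hp2, and_true, mem_ball, dist_eq_norm, mem_Ioo, hp1, true_and]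
    have : ‖circleMap z p.1 p.2 - z‖ = p.1 := by simp [abs_of_pos hp1]
    rw [this]
    split_ifs <;> simp
  have hint : IntegrableOn (fun p : ℝ × ℝ => p.1 * u (circleMap z p.1 p.2))
      (Ioo 0 r ×ˢ Ioo (-π) π) := by
    have : ContinuousOn (fun p : ℝ × ℝ => p.1 * u (circleMap z p.1 p.2))
        (Icc 0 r ×ˢ Icc (-π) π) := by
      refine continuousOn_fst.mul (hcu.comp ?_ ?_)
      · unfold circleMap
        fun_prop
      · intro p hp
        exact closedBall_subset_closedBall hp.1.2 (circleMap_mem_closedBall z hp.1.1 p.2)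
    exact (this.integrableOn_compact (isCompact_Icc.prod isCompact_Icc)).mono_set
      (prod_mono Ioo_subset_Icc_self Ioo_subset_Icc_self)
  rw [e1, Measure.volume_eq_prod, setIntegral_prod _ (by simpa [Measure.volume_eq_prod] using hint)]
  have hint2 : IntegrableOn (fun s : ℝ => ∫ θ in Ioo (-π) π, s * u (circleMap z s θ)) (Ioo 0 r) := by
    have : Integrable (fun p : ℝ × ℝ => p.1 * u (circleMap z p.1 p.2))
      ((volume.restrict (Ioo 0 r)).prod (volume.restrict (Ioo (-π) π))) := by
      rw [Measure.prod_restrict]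
      exact hint
    exact this.integral_prod_left
  have e2 : 2 * π * ‖deriv h z‖ * (r ^ 3 / 3) = ∫ s in Ioo 0 r, (2 * π * ‖deriv h z‖) * s ^ 2 := by
    rw [integral_const_mul, ← integral_Ioc_eq_integral_Ioo,
      ← intervalIntegral.integral_of_le hr.le, integral_pow]
    norm_num
  rw [e2]
  refine setIntegral_mono_on ?_ hint2 measurableSet_Ioo ?_
  · exact (Continuous.integrableOn_Icc (by fun_prop)).mono_set Ioo_subset_Icc_self
  · intro s hs
    have := circ h g hh hg z s hs.1 ((closedBall_subset_closedBall hs.2.le).trans hz)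
    rw [integral_const_mul, ← integral_Ioc_eq_integral_Ioo,
      ← intervalIntegral.integral_of_le (by linarith [Real.pi_pos])]
    have h2 := mul_le_mul_of_nonneg_left this hs.1.le
    refine le_trans (le_of_eq ?_) h2
    ring

theorem lam_bound (f : ℂ → ℂ) (hf : IsHarmonicOn f (ball (0 : ℂ) 1)) (c : ℂ) (z : ℂ) (r : ℝ)
    (hr : 0 < r) (hz : closedBall z r ⊆ ball (0:ℂ) 1) :
    2 * π * Lam f z * (r ^ 3 / 3) ≤ 2 * ∫ w in ball z r, ‖f w - c‖ := by
  obtain ⟨h, g, hh, hg, hfe⟩ := decomp f hf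
  have hz0 : z ∈ ball (0:ℂ) 1 := hz (mem_closedBall_self hr.le)
  rw [(wirt f h g hh hg hfe z hz0).2.2]
  have h1 := polar_bound (fun w => h w - c) g (by fun_prop) hg z r hr hz
  have h2 := polar_bound g (fun w => h w - c) hg (by fun_prop) z r hr hz
  have e1 : ∫ w in ball z r, ‖h w - c + (starRingEnd ℂ) (g w)‖ = ∫ w in ball z r, ‖f w - c‖ := by
    refine setIntegral_congr_fun measurableSet_ball fun w hw => ?_
    simp only [hfe w (hz (ball_subset_closedBall hw))]
    congr 1
    ring
  have e2 : ∫ w in ball z r, ‖g w + (starRingEnd ℂ) (h w - c)‖ = ∫ w in ball z r, ‖f w - c‖ := by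
    refine setIntegral_congr_fun measurableSet_ball fun w hw => ?_
    simp only [hfe w (hz (ball_subset_closedBall hw))]
    rw [← Complex.norm_conj]
    congr 1
    simp
    ring
  rw [e1, deriv_sub_const] at h1
  rw [e2] at h2
  linarith

theorem forward (f : ℂ → ℂ) (hf : IsHarmonicOn f (ball (0 : ℂ) 1)) (hb : bmoNorm f 1 ≠ ⊤) :
    ∃ M > (0 : ℝ), ∀ z ∈ ball (0 : ℂ) 1, Lam f z ≤ M / (1 - ‖z‖) := by
  set K := (bmoNorm f 1).toReal with hK
  have hK0 : 0 ≤ K := ENNReal.toReal_nonneg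
  refine ⟨6 * K + 1, by positivity, fun z hz => ?_⟩
  have hz1 : ‖z‖ < 1 := by simpa using hz
  set r := (1 - ‖z‖) / 2 with hr
  have hr0 : 0 < r := by rw [hr]; linarith
  have hsub : closedBall z r ⊆ ball (0:ℂ) 1 := by
    intro w hw
    rw [mem_closedBall, dist_eq_norm] at hw
    rw [mem_ball_zero_iff]
    have := norm_add_le (w - z) z
    rw [sub_add_cancel] at this
    linarith
  set c := (π * r ^ 2)⁻¹ • ∫ ξ in ball z r, f ξ with hc
  have hle : ENNReal.ofReal ((π * r ^ 2)⁻¹ * ∫ ζ in ball z r, ‖f ζ - c‖) ≤ bmoNorm f 1 := by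
    unfold bmoNorm
    refine le_iSup_of_le z (le_iSup_of_le hz1 (le_iSup_of_le r (le_iSup_of_le hr0
      (le_iSup_of_le (by linarith) ?_))))
    simp only [Real.rpow_one, div_one]
    exact le_rfl
  have hle2 := (ENNReal.ofReal_le_iff_le_toReal hb).1 hle
  have hl := lam_bound f hf c z r hr0 hsub
  have h3 : ∫ ζ in ball z r, ‖f ζ - c‖ ≤ (π * r ^ 2) * K := by
    rwa [inv_mul_le_iff₀ (by positivity)] at hle2
  have e : 1 - ‖z‖ = 2 * r := by rw [hr]; ring
  rw [e, le_div_iff₀ (by positivity)]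
  have h4 : (π * r ^ 2) * (2 * Lam f z * r / 3) ≤ (π * r ^ 2) * (2 * K) := by linarith
  have h5 := le_of_mul_le_mul_left h4 (by positivity)
  linarith

theorem log_int : IntegrableOn (fun w : ℂ => -Real.log (1 - ‖w‖)) (ball (0:ℂ) 1) := by
  rw [integrableOn_fun_norm_addHaar volume (f := fun x : ℝ => -Real.log (1 - x))]
  simp only [Complex.finrank_real_complex, smul_eq_mul]
  have h1 : IntervalIntegrable (fun x : ℝ => Real.log (1 - x)) volume 0 1 := by
    have := (intervalIntegral.intervalIntegrable_log' (a := 1) (b := 0)).comp_sub_left 1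
    simpa using this
  have h2 : IntervalIntegrable (fun x : ℝ => x ^ (2 - 1) * -Real.log (1 - x)) volume 0 1 :=
    h1.neg.continuousOn_mul (by fun_prop)
  rw [intervalIntegrable_iff_integrableOn_Ioo_of_le zero_le_one] at h2
  exact h2

theorem osc (f h g : ℂ → ℂ) (hh : DifferentiableOn ℂ h (ball 0 1))
    (hg : DifferentiableOn ℂ g (ball 0 1))
    (hfe : ∀ z ∈ ball (0:ℂ) 1, f z = h z + (starRingEnd ℂ) (g z))
    (M : ℝ) (hM : 0 < M) (hL : ∀ z ∈ ball (0 : ℂ) 1, Lam f z ≤ M / (1 - ‖z‖))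
    (z : ℂ) (r : ℝ) (hr : 0 < r) (hrz : r ≤ 1 - ‖z‖) (w : ℂ) (hw : w ∈ ball z r) :
    ‖f w - f z‖ ≤ M * -Real.log (1 - ‖r⁻¹ • (w - z)‖) := by
  rw [mem_ball, dist_eq_norm] at hw
  set ρ := ‖w - z‖ with hρ
  have hρ0 : 0 ≤ ρ := norm_nonneg _
  have hn : ‖r⁻¹ • (w - z)‖ = ρ / r := by
    rw [norm_smul, norm_inv, Real.norm_of_nonneg hr.le]; field_simp; rfl
  rw [hn]
  have hq : ρ / r < 1 := by rwa [div_lt_one hr]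
  have hq0 : 0 ≤ ρ / r := by positivity
  have hnorm : ∀ t ∈ Icc (0:ℝ) 1, ‖z + t • (w - z)‖ ≤ ‖z‖ + t * ρ := by
    intro t ht
    refine (norm_add_le _ _).trans ?_
    rw [norm_smul, Real.norm_of_nonneg ht.1]
  have htρ : ∀ t ∈ Icc (0:ℝ) 1, t * ρ ≤ ρ := fun t ht => mul_le_of_le_one_left hρ0 ht.2
  have hmem : ∀ t ∈ Icc (0:ℝ) 1, z + t • (w - z) ∈ ball (0:ℂ) 1 := by
    intro t ht
    rw [mem_ball_zero_iff]
    linarith [hnorm t ht, htρ t ht]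
  have hpos : ∀ t ∈ Icc (0:ℝ) 1, 0 < 1 - t * (ρ / r) := by
    intro t ht
    have := mul_le_of_le_one_left hq0 ht.2
    linarith
  have hd : ∀ t ∈ Icc (0:ℝ) 1, HasDerivAt (fun t : ℝ => f (z + t • (w - z)) - f z)
      (fderiv ℝ f (z + t • (w - z)) (w - z)) t := by
    intro t ht
    have h1 := (wirt f h g hh hg hfe _ (hmem t ht)).1.hasFDerivAt
    have h2 : HasDerivAt (fun t : ℝ => z + t • (w - z)) (w - z) t := by
      simpa using ((hasDerivAt_id t).smul_const (w - z)).const_add z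
    exact (h1.comp_hasDerivAt t h2).sub_const _
  have hB : ∀ t ∈ Icc (0:ℝ) 1, HasDerivAt (fun t : ℝ => M * -Real.log (1 - t * (ρ / r)))
      (M * (ρ / r) / (1 - t * (ρ / r))) t := by
    intro t ht
    have h1 : HasDerivAt (fun t : ℝ => 1 - t * (ρ / r)) (-(ρ / r)) t := by
      simpa using ((hasDerivAt_id t).mul_const (ρ / r)).const_sub 1
    have h2 := ((h1.log (hpos t ht).ne').neg).const_mul M
    convert! h2 using 1
    ring
  have key := image_norm_le_of_norm_deriv_right_le_deriv_boundary' (a := (0:ℝ)) (b := 1)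
    (f := fun t : ℝ => f (z + t • (w - z)) - f z)
    (f' := fun t : ℝ => fderiv ℝ f (z + t • (w - z)) (w - z))
    (B := fun t : ℝ => M * -Real.log (1 - t * (ρ / r)))
    (B' := fun t : ℝ => M * (ρ / r) / (1 - t * (ρ / r)))
    (fun t ht => (hd t ht).continuousAt.continuousWithinAt)
    (fun t ht => (hd t (Ico_subset_Icc_self ht)).hasDerivWithinAt)
    (by simp)
    (fun t ht => (hB t ht).continuousAt.continuousWithinAt)
    (fun t ht => (hB t (Ico_subset_Icc_self ht)).hasDerivWithinAt)
    (by
      intro t ht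
      have ht := Ico_subset_Icc_self ht
      obtain ⟨-, h5, h6⟩ := wirt f h g hh hg hfe _ (hmem t ht)
      have h7 := hL _ (hmem t ht)
      have h8 : r - t * ρ ≤ 1 - ‖z + t • (w - z)‖ := by linarith [hnorm t ht]
      have h9 : 0 < r - t * ρ := by linarith [htρ t ht]
      calc ‖fderiv ℝ f (z + t • (w - z)) (w - z)‖ ≤ Lam f (z + t • (w - z)) * ρ := by
            rw [h5, h6]
            refine (norm_add_le _ _).trans (le_of_eq ?_)
            rw [Complex.norm_conj, norm_mul, norm_mul]
            ring
        _ ≤ (M / (r - t * ρ)) * ρ := by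
            refine mul_le_mul_of_nonneg_right (h7.trans ?_) hρ0
            exact div_le_div_of_nonneg_left hM.le h9 h8
        _ = M * (ρ / r) / (1 - t * (ρ / r)) := by
            have := hpos t ht
            have e : r - t * ρ = r * (1 - t * (ρ / r)) := by field_simp
            rw [e]
            field_simp)
  have := key (right_mem_Icc.2 zero_le_one)
  simpa using this

theorem backward (f : ℂ → ℂ) (hf : IsHarmonicOn f (ball (0 : ℂ) 1))
    (M : ℝ) (hM : 0 < M) (hL : ∀ z ∈ ball (0 : ℂ) 1, Lam f z ≤ M / (1 - ‖z‖)) :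
    bmoNorm f 1 ≠ ⊤ := by
  obtain ⟨h, g, hh, hg, hfe⟩ := decomp f hf
  set L : ℂ → ℝ := (ball (0:ℂ) 1).indicator (fun w : ℂ => -Real.log (1 - ‖w‖)) with hLdef
  have hLint : Integrable L := (integrable_indicator_iff measurableSet_ball).2 log_int
  set A := ∫ w, L w with hA
  have hb : bmoNorm f 1 ≤ ENNReal.ofReal (2 * M * A / π) := by
    unfold bmoNorm
    refine iSup_le fun z => iSup_le fun hz => iSup_le fun r => iSup_le fun hr => iSup_le fun hrz => ?_
    simp only [Real.rpow_one, div_one]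
    apply ENNReal.ofReal_le_ofReal
    set c := (π * r ^ 2)⁻¹ • ∫ ξ in ball z r, f ξ with hc
    have hsub : ball z r ⊆ ball (0:ℂ) 1 := by
      intro w hw
      rw [mem_ball, dist_eq_norm] at hw
      rw [mem_ball_zero_iff]
      have := norm_add_le (w - z) z
      rw [sub_add_cancel] at this
      linarith
    set G : ℂ → ℝ := fun w => M * L (r⁻¹ • (w - z)) with hG
    have hGint : Integrable G :=
      ((hLint.comp_smul (inv_ne_zero hr.ne')).comp_sub_right z).const_mul M
    have hmemG : ∀ w, r⁻¹ • (w - z) ∈ ball (0:ℂ) 1 ↔ w ∈ ball z r := by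
      intro w
      rw [mem_ball_zero_iff, mem_ball, dist_eq_norm, norm_smul, norm_inv,
        Real.norm_of_nonneg hr.le, inv_mul_lt_iff₀ hr, mul_one]
    have hGI : ∫ w in ball z r, G w = M * (r ^ 2 * A) := by
      rw [setIntegral_eq_integral_of_forall_compl_eq_zero]
      · simp only [hG]
        rw [integral_const_mul, integral_sub_right_eq_self (fun w => L (r⁻¹ • w)) z,
          Measure.integral_comp_inv_smul_of_nonneg _ _ hr.le]
        simp [hA, Complex.finrank_real_complex]
      · intro w hw
        simp only [hG, hLdef]
        rw [indicator_of_notMem (by rwa [hmemG]), mul_zero]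
    have hbd : ∀ w ∈ ball z r, ‖f w - f z‖ ≤ G w := by
      intro w hw
      have := osc f h g hh hg hfe M hM hL z r hr hrz w hw
      simp only [hG, hLdef]
      rwa [indicator_of_mem (by rwa [hmemG])]
    have hfc : ContinuousOn f (ball z r) := hf.1.continuousOn.mono hsub
    have hvol : volume.real (ball z r) = π * r ^ 2 := by
      simp [Measure.real, Complex.volume_ball, hr.le]
      ring
    have hI : IntegrableOn (fun w => f w - f z) (ball z r) := by
      refine Integrable.mono' hGint.integrableOn
        ((hfc.sub continuousOn_const).aestronglyMeasurable measurableSet_ball) ?_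
      filter_upwards [ae_restrict_mem measurableSet_ball] with w hw using hbd w hw
    have hIn : ∫ w in ball z r, ‖f w - f z‖ ≤ M * (r ^ 2 * A) := by
      rw [← hGI]
      exact setIntegral_mono_on hI.norm hGint.integrableOn measurableSet_ball hbd
    have hfin : volume (ball z r) ≠ ⊤ := measure_ball_lt_top.ne
    have hconst : IntegrableOn (fun _ : ℂ => f z) (ball z r) := integrableOn_const hfin
    have hpr : 0 < π * r ^ 2 := by positivity
    have hcz : f z - c = -((π * r ^ 2)⁻¹ • ∫ ξ in ball z r, (f ξ - f z)) := by
      have hfI : IntegrableOn f (ball z r) := by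
        have := hI.add hconst
        refine this.congr ?_
        filter_upwards with w
        simp
      rw [integral_sub hfI hconst, setIntegral_const, hvol, smul_sub, smul_smul,
        inv_mul_cancel₀ hpr.ne', one_smul, hc]
      abel
    have hczn : ‖f z - c‖ ≤ (π * r ^ 2)⁻¹ * (M * (r ^ 2 * A)) := by
      rw [hcz, norm_neg, norm_smul, Real.norm_of_nonneg (by positivity)]
      exact mul_le_mul_of_nonneg_left ((norm_integral_le_integral_norm _).trans hIn) (by positivity)
    have hfin2 : ∫ ζ in ball z r, ‖f ζ - c‖ ≤ M * (r ^ 2 * A) + (π * r ^ 2) * ‖f z - c‖ := by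
      have hcI : IntegrableOn (fun _ : ℂ => ‖f z - c‖) (ball z r) := integrableOn_const hfin
      have h1 : ∫ ζ in ball z r, ‖f ζ - c‖ ≤ ∫ ζ in ball z r, (‖f ζ - f z‖ + ‖f z - c‖) := by
        refine integral_mono_of_nonneg (Filter.Eventually.of_forall fun _ => norm_nonneg _)
          (hI.norm.add hcI) (Filter.Eventually.of_forall fun w => ?_)
        exact norm_sub_le_norm_sub_add_norm_sub _ _ _
      rw [integral_add hI.norm hcI, setIntegral_const, hvol, smul_eq_mul] at h1
      linarith
    rw [inv_mul_le_iff₀ hpr]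
    have h3 := mul_le_mul_of_nonneg_left hczn hpr.le
    rw [mul_inv_cancel_left₀ hpr.ne'] at h3
    have e : π * r ^ 2 * (2 * M * A / π) = 2 * (M * (r ^ 2 * A)) := by
      field_simp
    rw [e]
    linarith
  exact ne_top_of_le_ne_top ENNReal.ofReal_ne_top hb

/-- Corollary 1: a harmonic mapping `f` in the unit disk belongs to
`BMO₁` (i.e. `‖f‖_{BMO₁} < ∞`) iff there is `M > 0` with `Λ_f(z) ≤ M / d(z)` on `𝔻`. -/
theorem stmt3 (f : ℂ → ℂ) (hf : IsHarmonicOn f (ball (0 : ℂ) 1)) :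
    bmoNorm f 1 ≠ ⊤ ↔
      ∃ M > (0 : ℝ), ∀ z ∈ ball (0 : ℂ) 1, Lam f z ≤ M / (1 - ‖z‖) := by
  exact ⟨forward f hf, fun ⟨M, hM, hL⟩ => backward f hf M hM hL⟩
end

section
/- Let f be a harmonic mapping in the unit disk D and p ∈ [2, ∞). Set M_p^p(r,f) = (1/2π) ∫_0^{2π} |f(re^{iθ})|^p dθ for r ∈ (0,1). Then M_p^p(r,f) is increasing in r on (0,1), and r (d/dr) M_p^p(r,f) = p ∫_{D_r} [ (p/2 − 1) |f(z)|^{p−4} |f_z(z) \overline{f(z)} + f(z) \overline{f_{z̄}(z)}|² + |f(z)|^{p−2} |∇̂f(z)|² ] dσ(z), where |∇̂f| = (|f_z|² + |f_{z̄}|²)^{1/2}. -/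
open Complex MeasureTheory Metric Set Real
open scoped ENNReal

/-- polar coordinates on a disc -/
lemma aux_polar (L : ℂ → ℝ) (hL : Continuous L) (r : ℝ) (hr : 0 < r) :
    ∫ z in ball (0 : ℂ) r, L z =
      ∫ ρ in (0:ℝ)..r, ∫ θ in (-π)..π, ρ * L ((ρ : ℂ) * Complex.exp ((θ : ℂ) * Complex.I)) := by
  have hc : Continuous (fun q : ℝ × ℝ =>
      q.1 * L ((q.1 : ℂ) * Complex.exp ((q.2 : ℂ) * Complex.I))) := by fun_prop
  rw [← integral_indicator measurableSet_ball, ← Complex.integral_comp_polarCoord_symm]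
  have hpi : -π ≤ π := by linarith [Real.pi_pos]
  have e1 : ∀ q ∈ polarCoord.target, q.1 • (ball (0:ℂ) r).indicator L (Complex.polarCoord.symm q)
      = (Ioo (0:ℝ) r ×ˢ Ioo (-π) π).indicator (fun q : ℝ × ℝ =>
      q.1 * L ((q.1 : ℂ) * Complex.exp ((q.2 : ℂ) * Complex.I))) q := by
    rintro ⟨a, b⟩ hq
    simp only [polarCoord_target, mem_prod, mem_Ioi] at hq
    have hn : ‖Complex.polarCoord.symm (a, b)‖ = a := by
      rw [Complex.norm_polarCoord_symm, abs_of_pos hq.1]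
    have hs : Complex.polarCoord.symm (a, b) = (a : ℂ) * Complex.exp ((b : ℂ) * Complex.I) := by
      rw [Complex.polarCoord_symm_apply, Complex.exp_mul_I]; simp
    by_cases h : a < r
    · rw [indicator_of_mem, indicator_of_mem, hs, smul_eq_mul]
      · exact ⟨⟨hq.1, h⟩, hq.2⟩
      · rw [mem_ball_zero_iff, hn]; exact h
    · rw [indicator_of_notMem, indicator_of_notMem, smul_zero]
      · exact fun h' => h h'.1.2
      · rw [mem_ball_zero_iff, hn]; exact h
  rw [setIntegral_congr_fun polarCoord.open_target.measurableSet e1,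
    setIntegral_indicator (measurableSet_Ioo.prod measurableSet_Ioo)]
  have e2 : polarCoord.target ∩ Ioo (0:ℝ) r ×ˢ Ioo (-π) π = Ioo (0:ℝ) r ×ˢ Ioo (-π) π := by
    apply inter_eq_right.2
    rintro ⟨a, b⟩ h
    exact ⟨h.1.1, h.2⟩
  rw [e2, Measure.volume_eq_prod, setIntegral_prod, intervalIntegral.integral_of_le hr.le,
    integral_Ioc_eq_integral_Ioo]
  · congr 1
    ext ρ
    rw [intervalIntegral.integral_of_le hpi, integral_Ioc_eq_integral_Ioo]
  · apply IntegrableOn.mono_set (t := Icc 0 r ×ˢ Icc (-π) π)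
    · exact hc.continuousOn.integrableOn_compact (isCompact_Icc.prod isCompact_Icc)
    · exact prod_mono Ioo_subset_Icc_self Ioo_subset_Icc_self

/-- Laplacian -/
noncomputable def auxLap (g : ℂ → ℝ) (z : ℂ) : ℝ :=
  fderiv ℝ (fun w => fderiv ℝ g w 1) z 1 + fderiv ℝ (fun w => fderiv ℝ g w Complex.I) z Complex.I

lemma auxLap_eq (g : ℂ → ℝ) (hg : ContDiff ℝ 2 g) (z : ℂ) :
    auxLap g z = fderiv ℝ (fderiv ℝ g) z 1 1
      + fderiv ℝ (fderiv ℝ g) z Complex.I Complex.I := by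
  have h1 : Differentiable ℝ (fderiv ℝ g) :=
    (hg.fderiv_right (m := 1) (by norm_num)).differentiable (by norm_num)
  have h2 : ∀ v : ℂ, fderiv ℝ (fun w => fderiv ℝ g w v) z v = fderiv ℝ (fderiv ℝ g) z v v := by
    intro v
    rw [((h1 z).hasFDerivAt.clm_apply (hasFDerivAt_const v z)).fderiv]
    simp
  rw [auxLap, h2, h2]

lemma auxLap_cont (g : ℂ → ℝ) (hg : ContDiff ℝ 2 g) : Continuous (auxLap g) := by
  have h1 : Continuous (fderiv ℝ (fderiv ℝ g)) :=
    (hg.fderiv_right (m := 1) (by norm_num)).continuous_fderiv (by norm_num)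
  rw [show auxLap g = _ from funext (auxLap_eq g hg)]
  fun_prop

/-- Green's formula on a disc -/
lemma aux_green (g : ℂ → ℝ) (hg : ContDiff ℝ 2 g) (r : ℝ) (hr : 0 < r) :
    r * ∫ θ in (-π)..π, fderiv ℝ g ((r : ℂ) * Complex.exp ((θ : ℂ) * Complex.I))
      (Complex.exp ((θ : ℂ) * Complex.I)) = ∫ z in ball (0 : ℂ) r, auxLap g z := by
  rw [aux_polar _ (auxLap_cont g hg) r hr]
  have hC1 : Continuous (fderiv ℝ g) := hg.continuous_fderiv (by norm_num)
  have hC2 : Continuous (fderiv ℝ (fderiv ℝ g)) :=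
    (hg.fderiv_right (m := 1) (by norm_num)).continuous_fderiv (by norm_num)
  have hD1 : Differentiable ℝ (fderiv ℝ g) :=
    (hg.fderiv_right (m := 1) (by norm_num)).differentiable (by norm_num)
  set e : ℝ → ℂ := fun θ => Complex.exp ((θ : ℂ) * Complex.I) with he
  have hec : Continuous e := by fun_prop
  have hde : ∀ θ, HasDerivAt e (Complex.I * e θ) θ := by
    intro θ
    have := ((Complex.ofRealCLM.hasDerivAt (x := θ)).mul_const Complex.I).cexp
    refine this.congr_deriv ?_
    simp [he, mul_comm]
  -- derivatives
  set A : ℝ → ℝ → ℝ := fun θ ρ => ρ * fderiv ℝ g ((ρ : ℂ) * e θ) (e θ) with hA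
  set A' : ℝ → ℝ → ℝ := fun θ ρ => fderiv ℝ g ((ρ : ℂ) * e θ) (e θ)
    + ρ * fderiv ℝ (fderiv ℝ g) ((ρ : ℂ) * e θ) (e θ) (e θ) with hA'
  set K : ℝ → ℝ → ℝ := fun ρ θ => fderiv ℝ g ((ρ : ℂ) * e θ) (Complex.I * e θ) with hK
  set K' : ℝ → ℝ → ℝ := fun ρ θ =>
    fderiv ℝ (fderiv ℝ g) ((ρ : ℂ) * e θ) ((ρ:ℂ) * (Complex.I * e θ)) (Complex.I * e θ)
    + fderiv ℝ g ((ρ : ℂ) * e θ) (Complex.I * (Complex.I * e θ)) with hK'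
  have dA : ∀ θ ρ, HasDerivAt (A θ) (A' θ ρ) ρ := by
    intro θ ρ
    have h0 : HasDerivAt (fun ρ : ℝ => (ρ : ℂ) * e θ) (e θ) ρ := by
      simpa using (Complex.ofRealCLM.hasDerivAt (x := ρ)).mul_const (e θ)
    have h1 := (hD1 ((ρ : ℂ) * e θ)).hasFDerivAt.comp_hasDerivAt ρ h0
    have h2 := (hasDerivAt_id ρ).mul (h1.clm_apply (hasDerivAt_const ρ (e θ)))
    refine h2.congr_deriv ?_
    simp [hA']
  have dK : ∀ ρ θ, HasDerivAt (K ρ) (K' ρ θ) θ := by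
    intro ρ θ
    have h0 : HasDerivAt (fun θ : ℝ => (ρ : ℂ) * e θ) ((ρ : ℂ) * (Complex.I * e θ)) θ := 
      (hde θ).const_mul _
    have h1 := (hD1 ((ρ : ℂ) * e θ)).hasFDerivAt.comp_hasDerivAt θ h0
    exact h1.clm_apply ((hde θ).const_mul Complex.I)
  have key : ∀ θ ρ, A' θ ρ = ρ * auxLap g ((ρ : ℂ) * e θ) - K' ρ θ := by
    intro θ ρ
    rw [auxLap_eq g hg]
    simp only [hA', hK']
    generalize fderiv ℝ (fderiv ℝ g) ((ρ : ℂ) * e θ) = B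
    generalize fderiv ℝ g ((ρ : ℂ) * e θ) = T
    have e1 : e θ = Real.cos θ • (1:ℂ) + Real.sin θ • Complex.I := by
      simp [he, Complex.exp_mul_I]
    have e2 : Complex.I * e θ = (- Real.sin θ) • (1:ℂ) + Real.cos θ • Complex.I := by
      rw [e1]; apply Complex.ext <;> simp
    have e3 : Complex.I * (Complex.I * e θ) = - e θ := by
      rw [← mul_assoc, Complex.I_mul_I]; ring
    have e4 : (ρ:ℂ) * (Complex.I * e θ) = ρ • (Complex.I * e θ) := by simp
    rw [e3, e4, e2, e1]
    simp only [map_add, map_smul, map_neg, add_apply,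
      smul_apply, smul_eq_mul]
    have := Real.sin_sq_add_cos_sq θ
    linear_combination (ρ * B 1 1 + ρ * B Complex.I Complex.I) * this
  have cA' : Continuous (Function.uncurry A') := by
    simp only [hA', Function.uncurry_def]; fun_prop
  have cK' : Continuous (Function.uncurry K') := by
    simp only [hK', Function.uncurry_def]; fun_prop
  have cL := auxLap_cont g hg
  have s1 : ∀ θ, A θ r = ∫ ρ in (0:ℝ)..r, A' θ ρ := by
    intro θ
    rw [intervalIntegral.integral_eq_sub_of_hasDerivAt (fun ρ _ => dA θ ρ)]
    · simp [hA]
    · exact Continuous.intervalIntegrable (by fun_prop) _ _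
  rw [← intervalIntegral.integral_const_mul]
  change ∫ θ in (-π)..π, A θ r = _
  simp_rw [s1]
  rw [intervalIntegral_intervalIntegral_swap]
  · congr 1
    ext ρ
    simp_rw [key]
    rw [intervalIntegral.integral_sub, intervalIntegral.integral_eq_sub_of_hasDerivAt (f := K ρ) (fun θ _ => dK ρ θ)]
    · have : e π = e (-π) := by simp [he, Complex.exp_neg]
      simp only [hK, this, sub_self, sub_zero]
      rfl
    · exact Continuous.intervalIntegrable (by fun_prop) _ _
    · exact Continuous.intervalIntegrable (by fun_prop) _ _
    · exact Continuous.intervalIntegrable (by fun_prop) _ _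
  · apply IntegrableOn.mono_set (t := uIcc (-π) π ×ˢ uIcc 0 r)
    · exact cA'.continuousOn.integrableOn_compact (isCompact_uIcc.prod isCompact_uIcc)
    · exact prod_mono uIoc_subset_uIcc uIoc_subset_uIcc

lemma aux_fderiv_u (F : ℂ → ℂ) (hF : ContDiff ℝ 2 F) (q ε : ℝ) (w v : ℂ)
    (h : ‖F w‖ ^ 2 + ε ≠ 0 ∨ 1 ≤ q) :
    HasFDerivAt (fun w => (‖F w‖ ^ 2 + ε) ^ q)
      ((q * (‖F w‖ ^ 2 + ε) ^ (q - 1)) • (2 • (innerSL ℝ (F w)).comp (fderiv ℝ F w))) w := by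
  have h1 : HasFDerivAt F (fderiv ℝ F w) w := (hF.differentiable (by norm_num) w).hasFDerivAt
  have := (h1.norm_sq.add_const ε).rpow_const (p := q) h
  exact this

lemma aux_fderiv_u' (F : ℂ → ℂ) (hF : ContDiff ℝ 2 F) (q ε : ℝ) (w v : ℂ)
    (h : ‖F w‖ ^ 2 + ε ≠ 0 ∨ 1 ≤ q) :
    fderiv ℝ (fun w => (‖F w‖ ^ 2 + ε) ^ q) w v =
      q * (‖F w‖ ^ 2 + ε) ^ (q - 1) * (2 * inner ℝ (F w) (fderiv ℝ F w v)) := by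
  rw [(aux_fderiv_u F hF q ε w v h).fderiv]
  simp only [smul_apply, ContinuousLinearMap.comp_apply, innerSL_apply_apply, smul_eq_mul,
    nsmul_eq_mul]
  push_cast
  ring

lemma aux_second (F : ℂ → ℂ) (hF : ContDiff ℝ 2 F) (q ε : ℝ) (hε : 0 < ε) (z v : ℂ) :
    fderiv ℝ (fun w => fderiv ℝ (fun w => (‖F w‖ ^ 2 + ε) ^ q) w v) z v =
      q * (q - 1) * (‖F z‖ ^ 2 + ε) ^ (q - 2) * (2 * inner ℝ (F z) (fderiv ℝ F z v)) ^ 2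
      + q * (‖F z‖ ^ 2 + ε) ^ (q - 1) * (2 * (‖fderiv ℝ F z v‖ ^ 2
        + inner ℝ (F z) (fderiv ℝ (fun w => fderiv ℝ F w v) z v))) := by
  have hpos : ∀ w, 0 < ‖F w‖ ^ 2 + ε := fun w => by positivity
  have e1 : (fun w => fderiv ℝ (fun w => (‖F w‖ ^ 2 + ε) ^ q) w v) = fun w =>
      q * (‖F w‖ ^ 2 + ε) ^ (q - 1) * (2 * inner ℝ (F w) (fderiv ℝ F w v)) := by
    ext w
    exact aux_fderiv_u' F hF q ε w v (Or.inl (hpos w).ne')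
  have hD1 : Differentiable ℝ (fderiv ℝ F) :=
    (hF.fderiv_right (m := 1) (by norm_num)).differentiable (by norm_num)
  have h1 : HasFDerivAt F (fderiv ℝ F z) z := (hF.differentiable (by norm_num) z).hasFDerivAt
  have h2 : HasFDerivAt (fun w => fderiv ℝ F w v) (fderiv ℝ (fun w => fderiv ℝ F w v) z) z :=
    DifferentiableAt.hasFDerivAt (by fun_prop)
  have h3 := ((aux_fderiv_u F hF (q-1) ε z v (Or.inl (hpos z).ne')).const_mul q).mul
    ((h1.inner ℝ h2).const_mul 2)
  rw [e1]
  change fderiv ℝ ((fun y => q * (‖F y‖ ^ 2 + ε) ^ (q - 1)) *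
    fun y => 2 * inner ℝ (F y) ((fderiv ℝ F y) v)) z v = _
  rw [h3.fderiv]
  simp only [add_apply, smul_apply, ContinuousLinearMap.comp_apply, innerSL_apply_apply,
    fderivInnerCLM_apply, ContinuousLinearMap.prod_apply, smul_eq_mul, nsmul_eq_mul,
    real_inner_self_eq_norm_sq]
  rw [show q - 1 - 1 = q - 2 by ring]
  push_cast
  ring

/-- `u_z` for `u = |F|²`. -/
noncomputable def auxW (F : ℂ → ℂ) (z : ℂ) : ℂ :=
  wirtingerZ F z * (starRingEnd ℂ) (F z) + F z * (starRingEnd ℂ) (wirtingerZbar F z)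

/-- `|∇̂F|²`. -/
noncomputable def auxS (F : ℂ → ℂ) (z : ℂ) : ℝ :=
  ‖wirtingerZ F z‖ ^ 2 + ‖wirtingerZbar F z‖ ^ 2

lemma auxS_eq (F : ℂ → ℂ) (z : ℂ) :
    2 * auxS F z = ‖fderiv ℝ F z 1‖ ^ 2 + ‖fderiv ℝ F z Complex.I‖ ^ 2 := by
  simp only [auxS, wirtingerZ, wirtingerZbar, ← Complex.normSq_eq_norm_sq, Complex.normSq_apply]
  simp [Complex.div_re, Complex.div_im, Complex.normSq_apply]
  ring

lemma auxW_eq (F : ℂ → ℂ) (z : ℂ) :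
    4 * ‖auxW F z‖ ^ 2 = (2 * inner ℝ (F z) (fderiv ℝ F z 1)) ^ 2
      + (2 * inner ℝ (F z) (fderiv ℝ F z Complex.I)) ^ 2 := by
  simp only [auxW, wirtingerZ, wirtingerZbar, ← Complex.normSq_eq_norm_sq, Complex.normSq_apply,
    Complex.inner]
  simp [Complex.div_re, Complex.div_im, Complex.normSq_apply]
  ring

lemma auxS_nonneg (F : ℂ → ℂ) (z : ℂ) : 0 ≤ auxS F z := by unfold auxS; positivity

lemma auxW_le (F : ℂ → ℂ) (z : ℂ) : ‖auxW F z‖ ^ 2 ≤ ‖F z‖ ^ 2 * (2 * auxS F z) := by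
  have h1 := abs_real_inner_le_norm (F z) (fderiv ℝ F z 1)
  have h2 := abs_real_inner_le_norm (F z) (fderiv ℝ F z Complex.I)
  have h1' := pow_le_pow_left₀ (abs_nonneg _) h1 2
  have h2' := pow_le_pow_left₀ (abs_nonneg _) h2 2
  rw [sq_abs, mul_pow] at h1' h2'
  rw [auxS_eq]
  nlinarith [auxW_eq F z]

lemma aux_lap (F : ℂ → ℂ) (hF : ContDiff ℝ 2 F) (q ε : ℝ) (hε : 0 < ε) (z : ℂ)
    (hh : fderiv ℝ (fun w => fderiv ℝ F w 1) z 1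
      + fderiv ℝ (fun w => fderiv ℝ F w Complex.I) z Complex.I = 0) :
    auxLap (fun w => (‖F w‖ ^ 2 + ε) ^ q) z =
      4 * q * ((q - 1) * (‖F z‖ ^ 2 + ε) ^ (q - 2) * ‖auxW F z‖ ^ 2
        + (‖F z‖ ^ 2 + ε) ^ (q - 1) * auxS F z) := by
  have h := congrArg (fun x => inner ℝ (F z) x) hh
  simp only [inner_add_right, inner_zero_right] at h
  rw [auxLap, aux_second F hF q ε hε, aux_second F hF q ε hε]
  linear_combination (2 * q * (‖F z‖ ^ 2 + ε) ^ (q - 1)) * h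
    - q * (q - 1) * (‖F z‖ ^ 2 + ε) ^ (q - 2) * auxW_eq F z
    - 2 * q * (‖F z‖ ^ 2 + ε) ^ (q - 1) * auxS_eq F z

lemma auxW_cont (F : ℂ → ℂ) (hF : ContDiff ℝ 2 F) : Continuous (auxW F) := by
  have hC1 : Continuous (fderiv ℝ F) := hF.continuous_fderiv (by norm_num)
  have := hF.continuous
  have := Complex.continuous_conj
  unfold auxW wirtingerZ wirtingerZbar
  fun_prop

lemma auxS_cont (F : ℂ → ℂ) (hF : ContDiff ℝ 2 F) : Continuous (auxS F) := by
  have hC1 : Continuous (fderiv ℝ F) := hF.continuous_fderiv (by norm_num)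
  unfold auxS wirtingerZ wirtingerZbar
  fun_prop

/-- The formula with `q = p / 2` for globally `C²` functions, harmonic on a disc. -/
lemma aux_main (F : ℂ → ℂ) (hF : ContDiff ℝ 2 F) (q : ℝ) (hq : 1 ≤ q) (r : ℝ) (hr : 0 < r)
    (hh : ∀ z ∈ ball (0:ℂ) r, fderiv ℝ (fun w => fderiv ℝ F w 1) z 1
      + fderiv ℝ (fun w => fderiv ℝ F w Complex.I) z Complex.I = 0) :
    r * ∫ θ in (-π)..π, fderiv ℝ (fun w => (‖F w‖ ^ 2) ^ q)
        ((r : ℂ) * Complex.exp ((θ : ℂ) * Complex.I)) (Complex.exp ((θ : ℂ) * Complex.I))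
    = ∫ z in ball (0:ℂ) r, 4 * q * ((q - 1) * (‖F z‖ ^ 2) ^ (q - 2) * ‖auxW F z‖ ^ 2
        + (‖F z‖ ^ 2) ^ (q - 1) * auxS F z) := by
  have hC0 := hF.continuous
  have hC1 : Continuous (fderiv ℝ F) := hF.continuous_fderiv (by norm_num)
  have cW := auxW_cont F hF
  have cS := auxS_cont F hF
  set ε : ℕ → ℝ := fun n => 1 / ((n:ℝ) + 1) with hεd
  have hε0 : ∀ n, 0 < ε n := fun n => Nat.one_div_pos_of_nat
  have hε1 : ∀ n, ε n ≤ 1 := fun n => by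
    rw [hεd]; simp only; rw [div_le_one (by positivity)]; linarith [(Nat.cast_nonneg n : (0:ℝ) ≤ n)]
  have hεl : Filter.Tendsto ε Filter.atTop (nhds 0) := tendsto_one_div_add_atTop_nhds_zero_nat
  have crp : Continuous fun x : ℝ => x ^ (q - 1) := Real.continuous_rpow_const (by linarith)
  set e : ℝ → ℂ := fun θ => Complex.exp ((θ : ℂ) * Complex.I) with he
  have hec : Continuous e := by fun_prop
  set N : ℝ → ℝ := fun t => r * ∫ θ in (-π)..π, q * (‖F (r * e θ)‖ ^ 2 + t) ^ (q - 1) *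
    (2 * inner ℝ (F (r * e θ)) (fderiv ℝ F (r * e θ) (e θ))) with hN
  have hNc : Continuous N := by
    apply Continuous.mul continuous_const
    apply intervalIntegral.continuous_parametric_intervalIntegral_of_continuous'
    simp only [Function.uncurry_def]
    have : Continuous fun x : ℝ × ℝ => (‖F (r * e x.2)‖ ^ 2 + x.1) ^ (q - 1) :=
      crp.comp (by fun_prop)
    fun_prop
  have hN0 : r * ∫ θ in (-π)..π, fderiv ℝ (fun w => (‖F w‖ ^ 2) ^ q)
        ((r : ℂ) * e θ) (e θ) = N 0 := by
    simp only [hN]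
    congr 2
    ext θ
    have := aux_fderiv_u' F hF q 0 (r * e θ) (e θ) (Or.inr hq)
    simpa only [add_zero] using this
  have hNn : ∀ n, N (ε n) = ∫ z in ball (0:ℂ) r,
      4 * q * ((q - 1) * (‖F z‖ ^ 2 + ε n) ^ (q - 2) * ‖auxW F z‖ ^ 2
        + (‖F z‖ ^ 2 + ε n) ^ (q - 1) * auxS F z) := by
    intro n
    have hpos : ∀ w, 0 < ‖F w‖ ^ 2 + ε n := fun w => by have := hε0 n; positivity
    have hg : ContDiff ℝ 2 (fun w => (‖F w‖ ^ 2 + ε n) ^ q) := by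
      apply ContDiff.rpow_const_of_ne
      · exact (hF.norm_sq ℝ).add contDiff_const
      · exact fun w => (hpos w).ne'
    rw [← setIntegral_congr_fun measurableSet_ball
      (fun z hz => aux_lap F hF q (ε n) (hε0 n) z (hh z hz)), ← aux_green _ hg r hr]
    simp only [hN]
    congr 2
    ext θ
    exact (aux_fderiv_u' F hF q (ε n) (r * e θ) (e θ) (Or.inr hq)).symm
  rw [hN0]
  refine tendsto_nhds_unique ((hNc.tendsto 0).comp hεl) ?_
  rw [show N ∘ ε = _ from funext hNn]
  apply tendsto_integral_of_dominated_convergence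
    (fun z => 4 * q * ((q - 1) * ((‖F z‖ ^ 2 + 1) ^ (q - 1) * (2 * auxS F z))
        + (‖F z‖ ^ 2 + 1) ^ (q - 1) * auxS F z))
  · intro n
    have hpos : ∀ w, 0 < ‖F w‖ ^ 2 + ε n := fun w => by have := hε0 n; positivity
    have c1 : Continuous fun z => (‖F z‖ ^ 2 + ε n) ^ (q - 2) :=
      Continuous.rpow_const (by fun_prop) (fun z => Or.inl (hpos z).ne')
    have c2 : Continuous fun z => (‖F z‖ ^ 2 + ε n) ^ (q - 1) := crp.comp (by fun_prop)
    exact Continuous.aestronglyMeasurable (by fun_prop)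
  · have c2 : Continuous fun z => (‖F z‖ ^ 2 + 1) ^ (q - 1) := crp.comp (by fun_prop)
    apply IntegrableOn.mono_set (t := closedBall 0 r) _ ball_subset_closedBall
    exact Continuous.continuousOn (by fun_prop) |>.integrableOn_compact (isCompact_closedBall 0 r)
  · intro n
    refine Filter.Eventually.of_forall fun z => ?_
    have hpos : 0 < ‖F z‖ ^ 2 + ε n := by have := hε0 n; positivity
    have hS := auxS_nonneg F z
    have hq1 : 0 ≤ q - 1 := by linarith
    have b1 : (‖F z‖ ^ 2 + ε n) ^ (q - 1) ≤ (‖F z‖ ^ 2 + 1) ^ (q - 1) :=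
      Real.rpow_le_rpow hpos.le (by linarith [hε1 n]) hq1
    have b2 : (‖F z‖ ^ 2 + ε n) ^ (q - 2) * ‖auxW F z‖ ^ 2
        ≤ (‖F z‖ ^ 2 + 1) ^ (q - 1) * (2 * auxS F z) := by
      calc (‖F z‖ ^ 2 + ε n) ^ (q - 2) * ‖auxW F z‖ ^ 2
          ≤ (‖F z‖ ^ 2 + ε n) ^ (q - 2) * ((‖F z‖ ^ 2 + ε n) * (2 * auxS F z)) := by
            gcongr
            refine (auxW_le F z).trans ?_
            gcongr
            linarith [hε0 n]
        _ = (‖F z‖ ^ 2 + ε n) ^ (q - 1) * (2 * auxS F z) := by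
            rw [← mul_assoc, ← Real.rpow_add_one hpos.ne']
            congr 2; ring
        _ ≤ _ := by gcongr
    rw [Real.norm_of_nonneg (by positivity), mul_assoc (q - 1)]
    gcongr
  · refine Filter.Eventually.of_forall fun z => ?_
    have l0 : Filter.Tendsto (fun n => ‖F z‖ ^ 2 + ε n) Filter.atTop (nhds (‖F z‖ ^ 2)) := by
      simpa using hεl.const_add (‖F z‖ ^ 2)
    have l1 : Filter.Tendsto (fun n => (‖F z‖ ^ 2 + ε n) ^ (q - 1)) Filter.atTop
        (nhds ((‖F z‖ ^ 2) ^ (q - 1))) := (crp.tendsto _).comp l0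
    have l2 : Filter.Tendsto (fun n => (q - 1) * (‖F z‖ ^ 2 + ε n) ^ (q - 2) * ‖auxW F z‖ ^ 2)
        Filter.atTop (nhds ((q - 1) * (‖F z‖ ^ 2) ^ (q - 2) * ‖auxW F z‖ ^ 2)) := by
      by_cases hz : F z = 0
      · have : auxW F z = 0 := by simp [auxW, hz]
        simp [this]
      · apply Filter.Tendsto.mul_const
        apply Filter.Tendsto.const_mul
        exact l0.rpow_const (Or.inl (by positivity))
    exact (l2.add (l1.mul_const _)).const_mul _

/-- derivative under the integral -/
lemma aux_deriv (F : ℂ → ℂ) (hF : ContDiff ℝ 2 F) (q : ℝ) (hq : 1 ≤ q) (r : ℝ) :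
    HasDerivAt (fun ρ : ℝ => ∫ θ in (-π)..π,
        (‖F ((ρ : ℂ) * Complex.exp ((θ : ℂ) * Complex.I))‖ ^ 2) ^ q)
      (∫ θ in (-π)..π, fderiv ℝ (fun w => (‖F w‖ ^ 2) ^ q)
        ((r : ℂ) * Complex.exp ((θ : ℂ) * Complex.I)) (Complex.exp ((θ : ℂ) * Complex.I))) r := by
  have hC0 := hF.continuous
  have hC1 : Continuous (fderiv ℝ F) := hF.continuous_fderiv (by norm_num)
  set g : ℂ → ℝ := fun w => (‖F w‖ ^ 2) ^ q with hg
  have crp : Continuous fun x : ℝ => x ^ (q - 1) := Real.continuous_rpow_const (by linarith)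
  have crp' : Continuous fun x : ℝ => x ^ q := Real.continuous_rpow_const (by linarith)
  have cg : Continuous g := crp'.comp (by fun_prop)
  have dg : Differentiable ℝ g := by
    intro w
    have := (aux_fderiv_u F hF q 0 w 0 (Or.inr hq)).differentiableAt
    simpa only [add_zero] using this
  set e : ℝ → ℂ := fun θ => Complex.exp ((θ : ℂ) * Complex.I) with he
  have hec : Continuous e := by fun_prop
  have cG : Continuous (fun x : ℝ × ℝ => fderiv ℝ g (x.1 * e x.2) (e x.2)) := by
    have : (fun x : ℝ × ℝ => fderiv ℝ g (x.1 * e x.2) (e x.2)) = fun x =>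
        q * (‖F (x.1 * e x.2)‖ ^ 2) ^ (q - 1) *
          (2 * inner ℝ (F (x.1 * e x.2)) (fderiv ℝ F (x.1 * e x.2) (e x.2))) := by
      ext x
      have := aux_fderiv_u' F hF q 0 (x.1 * e x.2) (e x.2) (Or.inr hq)
      simpa only [add_zero] using this
    rw [this]
    have c2 : Continuous fun x : ℝ × ℝ => (‖F (x.1 * e x.2)‖ ^ 2) ^ (q - 1) :=
      crp.comp (by fun_prop)
    fun_prop
  obtain ⟨C, hC⟩ := ((isCompact_closedBall r 1).prod (isCompact_uIcc (a := -π) (b := π))).exists_bound_of_continuousOn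
    cG.continuousOn
  refine (intervalIntegral.hasDerivAt_integral_of_dominated_loc_of_deriv_le
    (F := fun (ρ : ℝ) θ => g (ρ * e θ)) (F' := fun (ρ : ℝ) θ => fderiv ℝ g (ρ * e θ) (e θ))
    (bound := fun _ => C) (s := closedBall r 1) (closedBall_mem_nhds r one_pos) ?_ ?_ ?_ ?_ ?_ ?_).2
  · exact Filter.Eventually.of_forall fun ρ => Continuous.aestronglyMeasurable (by fun_prop)
  · exact Continuous.intervalIntegrable (by fun_prop) _ _
  · exact Continuous.aestronglyMeasurable (cG.comp (by fun_prop : Continuous fun θ : ℝ => (r, θ)))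
  · exact Filter.Eventually.of_forall fun θ hθ ρ hρ => hC (ρ, θ) ⟨hρ, uIoc_subset_uIcc hθ⟩
  · exact intervalIntegrable_const
  · refine Filter.Eventually.of_forall fun θ hθ ρ hρ => ?_
    have h0 : HasDerivAt (fun ρ : ℝ => (ρ : ℂ) * e θ) (e θ) ρ := by
      simpa using (Complex.ofRealCLM.hasDerivAt (x := ρ)).mul_const (e θ)
    exact (dg ((ρ : ℂ) * e θ)).hasFDerivAt.comp_hasDerivAt ρ h0

/-- globally `C²` function agreeing with `f` on a smaller disc -/
lemma aux_ext (f : ℂ → ℂ) (hf : ContDiffOn ℝ 2 f (ball (0:ℂ) 1)) (R : ℝ) (h0 : 0 < R)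
    (h1 : R < 1) : ∃ F : ℂ → ℂ, ContDiff ℝ 2 F ∧ ∀ z ∈ ball (0:ℂ) R, F z = f z := by
  let φ : ContDiffBump (0:ℂ) := ⟨R, (R + 1) / 2, h0, by linarith⟩
  refine ⟨fun z => φ z • f z, ?_, ?_⟩
  · rw [contDiff_iff_contDiffAt]
    intro z
    by_cases hz : z ∈ ball (0:ℂ) 1
    · exact φ.contDiff.contDiffAt.smul (hf.contDiffAt (isOpen_ball.mem_nhds hz))
    · have hz' : z ∈ (closedBall (0:ℂ) ((R + 1) / 2))ᶜ := by
        simp only [mem_ball, dist_zero_right, mem_compl_iff, mem_closedBall] at hz ⊢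
        linarith
      apply (contDiffAt_const (c := (0:ℂ))).congr_of_eventuallyEq
      filter_upwards [isClosed_closedBall.isOpen_compl.mem_nhds hz'] with w hw
      rw [φ.zero_of_le_dist, zero_smul]
      simp only [mem_compl_iff, mem_closedBall, not_le] at hw
      exact hw.le
  · intro z hz
    simp only
    rw [φ.one_of_mem_closedBall (ball_subset_closedBall hz), one_smul]

lemma aux_key (f : ℂ → ℂ) (hf : IsHarmonicOn f (ball (0 : ℂ) 1)) (p : ℝ) (hp : 2 ≤ p)
    (r : ℝ) (hr : r ∈ Ioo (0:ℝ) 1) : ∃ D : ℝ,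
    HasDerivAt (fun ρ : ℝ => (1 / (2 * π)) *
            ∫ θ in (0:ℝ)..(2 * π), ‖f ((ρ : ℂ) * Complex.exp ((θ : ℂ) * Complex.I))‖ ^ p) D r ∧
    r * D = p * ((1 / π) *
            ∫ z in ball (0 : ℂ) r,
              ((p / 2 - 1) * ‖f z‖ ^ (p - 4) *
                  ‖wirtingerZ f z * (starRingEnd ℂ) (f z)
                      + f z * (starRingEnd ℂ) (wirtingerZbar f z)‖ ^ 2
                + ‖f z‖ ^ (p - 2) * (‖wirtingerZ f z‖ ^ 2 + ‖wirtingerZbar f z‖ ^ 2))) := by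
  obtain ⟨hr0, hr1⟩ := hr
  obtain ⟨R, hrR, hR1⟩ := exists_between hr1
  obtain ⟨F, hF, hFf⟩ := aux_ext f hf.1 R (hr0.trans hrR) hR1
  have hev : ∀ z ∈ ball (0:ℂ) R, F =ᶠ[nhds z] f := fun z hz => by
    filter_upwards [isOpen_ball.mem_nhds hz] with w hw using hFf w hw
  have hfd : ∀ z ∈ ball (0:ℂ) R, fderiv ℝ F z = fderiv ℝ f z := fun z hz => (hev z hz).fderiv_eq
  have hsub : ball (0:ℂ) r ⊆ ball 0 R := ball_subset_ball hrR.le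
  have hharm : ∀ z ∈ ball (0:ℂ) r, fderiv ℝ (fun w => fderiv ℝ F w 1) z 1
      + fderiv ℝ (fun w => fderiv ℝ F w Complex.I) z Complex.I = 0 := by
    intro z hz
    have h : ∀ v : ℂ, fderiv ℝ (fun w => fderiv ℝ F w v) z = fderiv ℝ (fun w => fderiv ℝ f w v) z := by
      intro v
      apply Filter.EventuallyEq.fderiv_eq
      filter_upwards [isOpen_ball.mem_nhds (hsub hz)] with w hw
      rw [hfd w hw]
    rw [h, h]
    exact hf.2 z (ball_subset_ball hR1.le (hsub hz))
  have hq : 1 ≤ p / 2 := by linarith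
  have hpow : ∀ (x s : ℝ), 0 ≤ x → (x ^ 2) ^ s = x ^ (2 * s) := by
    intro x s hx
    rw [← Real.rpow_natCast, ← Real.rpow_mul hx]
    norm_num
  have hd := (aux_deriv F hF (p / 2) hq r).const_mul (1 / (2 * π))
  have hm := aux_main F hF (p / 2) hq r hr0 hharm
  refine ⟨_, hd.congr_of_eventuallyEq ?_, ?_⟩
  · filter_upwards [Ioo_mem_nhds hr0 hrR] with ρ hρ
    congr 1
    have hper : Function.Periodic
        (fun θ : ℝ => ‖f ((ρ : ℂ) * Complex.exp ((θ : ℂ) * Complex.I))‖ ^ p) (2 * π) := by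
      intro θ
      simp only
      congr 4
      push_cast
      rw [add_mul, Complex.exp_add, Complex.exp_two_pi_mul_I, mul_one]
    have h := hper.intervalIntegral_add_eq 0 (-π)
    rw [zero_add, show -π + 2 * π = π by ring] at h
    rw [h]
    congr 1
    ext θ
    rw [hpow _ _ (norm_nonneg _), hFf]
    · congr 1; ring
    · rw [mem_ball_zero_iff, norm_mul, Complex.norm_exp_ofReal_mul_I, mul_one, Complex.norm_real,
        Real.norm_of_nonneg hρ.1.le]
      exact hρ.2
  · rw [mul_left_comm, hm, integral_const_mul]
    have : ∫ z in ball (0:ℂ) r, ((p / 2 - 1) * (‖F z‖ ^ 2) ^ (p / 2 - 2) * ‖auxW F z‖ ^ 2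
        + (‖F z‖ ^ 2) ^ (p / 2 - 1) * auxS F z) = ∫ z in ball (0 : ℂ) r,
              ((p / 2 - 1) * ‖f z‖ ^ (p - 4) *
                  ‖wirtingerZ f z * (starRingEnd ℂ) (f z)
                      + f z * (starRingEnd ℂ) (wirtingerZbar f z)‖ ^ 2
                + ‖f z‖ ^ (p - 2) * (‖wirtingerZ f z‖ ^ 2 + ‖wirtingerZbar f z‖ ^ 2)) := by
      apply setIntegral_congr_fun measurableSet_ball
      intro z hz
      simp only
      rw [hpow _ _ (norm_nonneg _), hpow _ _ (norm_nonneg _), auxW, auxS, wirtingerZ,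
        wirtingerZbar, wirtingerZ, wirtingerZbar, hfd z (hsub hz), hFf z (hsub hz),
        show 2 * (p / 2 - 2) = p - 4 by ring, show 2 * (p / 2 - 1) = p - 2 by ring]
    rw [this]
    field_simp
    ring

/-- Lemma 4: let `f` be harmonic in the unit disk, `p ∈ [2,∞)`,
and `M_p^p(r,f) = (1/2π) ∫₀^{2π} |f(re^{iθ})|^p dθ`. Then `M_p^p(·,f)` is increasing
on `(0,1)` and
`r (d/dr) M_p^p(r,f) = p ∫_{D_r} [(p/2-1)|f|^{p-4} |f_z f̄ + f f̄_z̄|² + |f|^{p-2} |∇̂f|²] dσ`,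
where `dσ` is the normalized area measure and `|∇̂f|² = |f_z|² + |f_z̄|²`. -/
theorem stmt16 (f : ℂ → ℂ) (hf : IsHarmonicOn f (ball (0 : ℂ) 1)) (p : ℝ) (hp : 2 ≤ p) :
    MonotoneOn
      (fun r : ℝ => (1 / (2 * π)) *
        ∫ θ in (0:ℝ)..(2 * π), ‖f ((r : ℂ) * Complex.exp ((θ : ℂ) * Complex.I))‖ ^ p)
      (Ioo (0:ℝ) 1) ∧
    ∀ r ∈ Ioo (0:ℝ) 1,
      r * deriv
          (fun ρ : ℝ => (1 / (2 * π)) *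
            ∫ θ in (0:ℝ)..(2 * π), ‖f ((ρ : ℂ) * Complex.exp ((θ : ℂ) * Complex.I))‖ ^ p) r
        = p * ((1 / π) *
            ∫ z in ball (0 : ℂ) r,
              ((p / 2 - 1) * ‖f z‖ ^ (p - 4) *
                  ‖wirtingerZ f z * (starRingEnd ℂ) (f z)
                      + f z * (starRingEnd ℂ) (wirtingerZbar f z)‖ ^ 2
                + ‖f z‖ ^ (p - 2) * (‖wirtingerZ f z‖ ^ 2 + ‖wirtingerZbar f z‖ ^ 2))) := by
  constructor
  · have hd : ∀ r ∈ Ioo (0:ℝ) 1, DifferentiableAt ℝ (fun r : ℝ => (1 / (2 * π)) *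
        ∫ θ in (0:ℝ)..(2 * π), ‖f ((r : ℂ) * Complex.exp ((θ : ℂ) * Complex.I))‖ ^ p) r := by
      intro r hr
      obtain ⟨D, h1, -⟩ := aux_key f hf p hp r hr
      exact h1.differentiableAt
    apply monotoneOn_of_deriv_nonneg (convex_Ioo 0 1)
    · exact fun r hr => (hd r hr).continuousAt.continuousWithinAt
    · rw [interior_Ioo]
      exact fun r hr => (hd r hr).differentiableWithinAt
    · rw [interior_Ioo]
      intro r hr
      obtain ⟨D, h1, h2⟩ := aux_key f hf p hp r hr
      rw [h1.deriv]
      refine nonneg_of_mul_nonneg_right ?_ hr.1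
      rw [h2]
      have : 0 ≤ p / 2 - 1 := by linarith
      have : 0 ≤ p := by linarith
      have hi := integral_nonneg (μ := volume.restrict (ball (0:ℂ) r)) (f := fun z =>
              ((p / 2 - 1) * ‖f z‖ ^ (p - 4) *
                  ‖wirtingerZ f z * (starRingEnd ℂ) (f z)
                      + f z * (starRingEnd ℂ) (wirtingerZbar f z)‖ ^ 2
                + ‖f z‖ ^ (p - 2) * (‖wirtingerZ f z‖ ^ 2 + ‖wirtingerZbar f z‖ ^ 2)))
          (fun z => by simp only [Pi.zero_apply]; positivity)
      have := Real.pi_pos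
      positivity
  · intro r hr
    obtain ⟨D, h1, h2⟩ := aux_key f hf p hp r hr
    rw [h1.deriv, h2]
end
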